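/- arXiv:1508.01900 — 11 statements merged into one kernel-verified Lean document; each statement's English description precedes it below -/
import Mathlib

section
/- Let N ≥ 1 and let k₁, …, k_N be integers with kᵢ ≥ 1 for all i. Write the 2×2 integer matrix product ∏_{i=1}^{N} [[0,1],[1,kᵢ]] (taken in this order) as [[p,q],[r,s]]. Let ν := ⌊N/2⌋ and let D be the finite list of integers obtained by concatenating, for i = 1, …, ν, the block consisting of (k_{2i−1} − 1) copies of 2 followed by the single entry k_{2i} + 2, and then — when N is odd — appending k_N further copies of 2. Let m be the length of D and let A be the m×m integer matrix with A_{jj} = D_j, A_{j,j+1} = A_{j+1,j} = −1, and all other entries 0. Then det A = r + s. (This is the computation k(S) = r + s for the unique branch of a one-branch Kato surface.) -/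
/-- The symmetric tridiagonal matrix with diagonal `d` and off-diagonal entries `-1`. -/
def negOneTridiagonal {R : Type*} [CommRing R] {n : ℕ} (d : Fin n → R) :
    Matrix (Fin n) (Fin n) R :=
  Matrix.of fun i j =>
    if i = j then d i
    else if i.val + 1 = j.val ∨ j.val + 1 = i.val then -1 else 0

/-- The three-term recurrence step `(x, y) ↦ (d * x - y, x)` for determinants of tridiagonal
matrices with off-diagonal entries `-1`. -/
def continuantStep {R : Type*} [CommRing R] (d : R) (v : R × R) : R × R :=
  (d * v.1 - v.2, v.1)

theorem negOneTridiagonal_submatrix_succ {R : Type*} [CommRing R] {n : ℕ} (d : Fin (n + 1) → R) :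
    (negOneTridiagonal d).submatrix Fin.succ Fin.succ =
      negOneTridiagonal fun i => d i.succ := by
  ext i j
  simp [negOneTridiagonal]

theorem det_negOneTridiagonal_succ_succ {R : Type*} [CommRing R] {n : ℕ} (d : Fin (n + 2) → R) :
    (negOneTridiagonal d).det =
      d 0 * (negOneTridiagonal fun i : Fin (n + 1) => d i.succ).det -
        (negOneTridiagonal fun i : Fin n => d i.succ.succ).det := by
  have hminor : ((negOneTridiagonal d).submatrix Fin.succ (Fin.succAbove 1)).det =
      -(negOneTridiagonal fun i : Fin n => d i.succ.succ).det := by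
    rw [Matrix.det_succ_column_zero, Fin.sum_univ_succ, Finset.sum_eq_zero]
    · have hsub : ((negOneTridiagonal d).submatrix Fin.succ (Fin.succAbove 1)).submatrix
          Fin.succ Fin.succ = negOneTridiagonal fun i : Fin n => d i.succ.succ := by
        ext i j
        simp [negOneTridiagonal, Fin.ext_iff, Fin.succAbove, Fin.lt_def]
      simp only [Fin.succAbove_zero, hsub]
      simp [negOneTridiagonal]
    · intro i _
      simp [negOneTridiagonal, Fin.ext_iff]
  rw [Matrix.det_succ_row_zero, Fin.sum_univ_succ, Fin.sum_univ_succ, Finset.sum_eq_zero]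
  · simp only [Fin.succAbove_zero, negOneTridiagonal_submatrix_succ, Fin.succ_zero_eq_one, hminor]
    simp [negOneTridiagonal]
    ring
  · intro i _
    simp [negOneTridiagonal, Fin.ext_iff]

theorem det_negOneTridiagonal_get {R : Type*} [CommRing R] :
    ∀ l : List R, (negOneTridiagonal l.get).det = (l.foldr continuantStep (1, 0)).1
  | [] => by simp
  | [a] => by simp [negOneTridiagonal, continuantStep]
  | a :: b :: l => by
    have h₁ := det_negOneTridiagonal_get (b :: l)
    have h₂ := det_negOneTridiagonal_get l
    refine (det_negOneTridiagonal_succ_succ (n := l.length) (a :: b :: l).get).trans ?_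
    exact congrArg₂ (fun x y => a * x - y) h₁ h₂

theorem foldr_continuantStep_replicate_two {R : Type*} [CommRing R] (n : ℕ) (v : R × R) :
    (List.replicate n 2).foldr continuantStep v =
      (v.1 + n * (v.1 - v.2), v.2 + n * (v.1 - v.2)) := by
  induction n with
  | zero => simp
  | succ n ih =>
    rw [List.replicate_succ, List.foldr_cons, ih]
    simp only [continuantStep, Nat.cast_succ, Prod.mk.injEq]
    constructor <;> ring

/-- The list of diagonal entries attached to `k 0, …, k (N - 1)`. -/
def branchDiagonal (N : ℕ) (k : ℕ → ℤ) : List ℤ :=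
  ((List.range (N / 2)).flatMap fun i =>
      List.replicate (k (2 * i) - 1).toNat 2 ++ [k (2 * i + 1) + 2]) ++
    (if N % 2 = 1 then List.replicate (k (N - 1)).toNat 2 else [])

theorem branchDiagonal_add_two (N : ℕ) (k : ℕ → ℤ) :
    branchDiagonal (N + 2) k =
      List.replicate (k 0 - 1).toNat 2 ++ (k 1 + 2) :: branchDiagonal N fun i => k (i + 2) := by
  have hlast : (if N % 2 = 1 then List.replicate (k (N + 1)).toNat (2 : ℤ) else []) =
      if N % 2 = 1 then List.replicate (k (N - 1 + 2)).toNat 2 else [] := by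
    split_ifs with h
    · rw [show N - 1 + 2 = N + 1 by omega]
    · rfl
  simp [branchDiagonal, List.range_succ_eq_map, List.flatMap_map, mul_add, add_right_comm, hlast]

/-- The recurrence vector `(u, w)` of the diagonal list corresponds to the vector
`(p + q, r + s)` of the matrix product via `u = r + s` and `u - w = p + q`. -/
theorem foldr_continuantStep_branchDiagonal :
    ∀ (N : ℕ) (k : ℕ → ℤ), (∀ i < N, 1 ≤ k i) →
      let M := (List.ofFn fun i : Fin N => !![0, 1; 1, k i.val]).prod
      (branchDiagonal N k).foldr continuantStep (1, 0) =
        (M 1 0 + M 1 1, M 1 0 + M 1 1 - (M 0 0 + M 0 1))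
  | 0, k, _ => by simp [branchDiagonal]
  | 1, k, hk => by
    simp [branchDiagonal, foldr_continuantStep_replicate_two]
    linarith [hk 0 one_pos]
  | N + 2, k, hk => by
    have ih := foldr_continuantStep_branchDiagonal N (fun i => k (i + 2))
      fun i hi => hk (i + 2) (by omega)
    have h : ((k 0 - 1).toNat : ℤ) = k 0 - 1 :=
      Int.toNat_of_nonneg (by linarith [hk 0 (by omega)])
    simp only [branchDiagonal_add_two, List.foldr_append, List.foldr_cons,
      foldr_continuantStep_replicate_two, ih, h, continuantStep, List.ofFn_succ, List.prod_cons,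
      Fin.val_succ, Fin.val_zero, Matrix.mul_apply, Fin.sum_univ_two, Prod.mk.injEq,
      zero_add, add_assoc, Nat.reduceAdd, Matrix.of_apply, Matrix.cons_val', Matrix.cons_val_zero,
      Matrix.cons_val_one, Matrix.cons_val_fin_one]
    constructor <;> ring

/-- the determinant of the tridiagonal intersection matrix of the
branch equals `r + s`, where `[[p,q],[r,s]]` is the ordered product of the
matrices `[[0,1],[1,kᵢ]]`. -/
theorem det_branch_matrix_eq_r_add_s
    (N : ℕ) (hN : 1 ≤ N) (k : ℕ → ℤ) (hk : ∀ i, i < N → 1 ≤ k i)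
    (M : Matrix (Fin 2) (Fin 2) ℤ)
    (hM : M = (List.ofFn fun i : Fin N => !![0, 1; 1, k i.val]).prod)
    (D : List ℤ)
    (hD : D = ((List.range (N / 2)).flatMap fun i =>
        List.replicate (k (2 * i) - 1).toNat 2 ++ [k (2 * i + 1) + 2]) ++
      (if N % 2 = 1 then List.replicate (k (N - 1)).toNat 2 else []))
    (A : Matrix (Fin D.length) (Fin D.length) ℤ)
    (hA : A = Matrix.of fun i j =>
      if i = j then D.get i
      else if i.val + 1 = j.val ∨ j.val + 1 = i.val then -1 else 0) :
    A.det = M 1 0 + M 1 1 := by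
  subst hM hD hA
  exact (det_negOneTridiagonal_get (branchDiagonal N k)).trans
    (congrArg Prod.fst (foldr_continuantStep_branchDiagonal N k hk))
end

section
/- Assume (H). Then the following are equivalent: (i) (r + s − 1) divides both p + s + r·l − 1 − δ and r + q + s·l − 1 + δ (equivalently, the rational numbers u := (p + s + r·l − 1 − δ)/(r + s − 1) and v := (r + q + s·l − 1 + δ)/(r + s − 1) are both integers); (ii) there exists an integer k ≥ 0 with l = d + k·(r + s − 1). -/
/-- arithmetic characterization of the existence of a nontrivial
global twisted vector field: `u = (p+s+rl-1-δ)/(r+s-1)` and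
`v = (r+q+sl-1+δ)/(r+s-1)` are both integers iff `l = d + k(r+s-1)` for some
integer `k ≥ 0`, where `d = (r+s)-(p+q)`. -/
theorem twisted_vector_field_criterion
    (p q r s l δ : ℤ)
    (hp : 0 ≤ p) (hq : 0 ≤ q) (hr : 1 ≤ r) (hs : 1 ≤ s) (hl : 1 ≤ l)
    (hδ : δ = p * s - q * r) (hδ1 : δ = 1 ∨ δ = -1) (hpq : p + q < r + s) :
    ((r + s - 1) ∣ (p + s + r * l - 1 - δ) ∧ (r + s - 1) ∣ (r + q + s * l - 1 + δ)) ↔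
      (∃ k : ℤ, 0 ≤ k ∧ l = ((r + s) - (p + q)) + k * (r + s - 1)) := by
  have hA : p + s + r * l - 1 - δ =
      r * (l - (r + s - (p + q))) + (r + s - 1) * (1 + r - p) := by
    rw [hδ]; ring
  have hB : r + q + s * l - 1 + δ =
      s * (l - (r + s - (p + q))) + (r + s - 1) * (1 + s - q) := by
    rw [hδ]; ring
  constructor
  · rintro ⟨⟨u, hu⟩, ⟨v, hv⟩⟩
    have hpq1 : 1 ≤ p + q := by
      by_contra! h
      obtain rfl : p = 0 := by lia
      obtain rfl : q = 0 := by lia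
      simp at hδ
      lia
    obtain ⟨k, hk⟩ : ∃ k, l - (r + s - (p + q)) = (r + s - 1) * k :=
      ⟨u + v - (1 + r - p) - (1 + s - q) - (l - (r + s - (p + q))), by
        linear_combination hu + hv - hA - hB⟩
    refine ⟨k, ?_, by linear_combination hk⟩
    by_contra! hneg
    nlinarith [mul_nonneg (show 0 ≤ r + s - 1 by lia) (show 0 ≤ -1 - k by lia)]
  · rintro ⟨k, -, hk⟩
    rw [hA, hB, show l - (r + s - (p + q)) = (r + s - 1) * k by linear_combination hk]
    exact ⟨⟨r * k + (1 + r - p), by ring⟩, ⟨s * k + (1 + s - q), by ring⟩⟩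
end

section
/- Assume (H). Let A, B be nonzero complex numbers satisfying B = A^r · B^s and A = A^{p+r·l} · B^{q+s·l}. Then A^{p+s+r·l−1−δ} = 1 and B^{p+s+r·l−1−δ} = 1; that is, A and B are roots of unity of order dividing p + s + r·l − 1 − δ (a nonnegative integer under (H)). -/
/-- Elimination of `y` from two monomial relations `x ^ a * y ^ b = 1` and `x ^ c * y ^ d = 1`:
the determinant of the exponent matrix kills `x`. -/
theorem zpow_det_eq_one {G : Type*} [CommGroup G] {x y : G} {a b c d : ℤ}
    (h : x ^ a * y ^ b = 1) (h' : x ^ c * y ^ d = 1) : x ^ (a * d - b * c) = 1 := by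
  calc x ^ (a * d - b * c) = (x ^ a * y ^ b) ^ d * (x ^ c * y ^ d) ^ (-b) := by
        rw [mul_zpow, mul_zpow, ← zpow_mul, ← zpow_mul, ← zpow_mul, ← zpow_mul,
          mul_mul_mul_comm, ← zpow_add, ← zpow_add]
        rw [show b * d + d * -b = 0 by ring, zpow_zero, mul_one]
        congr 1
        ring
    _ = 1 := by rw [h, h', one_zpow, one_zpow, one_mul]

/-- if nonzero complex numbers `A, B` satisfy `B = A^r B^s` and
`A = A^{p+rl} B^{q+sl}`, then `A` and `B` are roots of unity of order dividing
`p + s + r·l - 1 - δ`. -/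
theorem diagonal_group_roots_of_unity
    (p q r s l δ : ℤ)
    (hp : 0 ≤ p) (hq : 0 ≤ q) (hr : 1 ≤ r) (hs : 1 ≤ s) (hl : 1 ≤ l)
    (hδ : δ = p * s - q * r) (hδ1 : δ = 1 ∨ δ = -1) (hpq : p + q < r + s)
    (A B : ℂ) (hA : A ≠ 0) (hB : B ≠ 0)
    (h1 : B = A ^ r.toNat * B ^ s.toNat)
    (h2 : A = A ^ (p + r * l).toNat * B ^ (q + s * l).toNat) :
    A ^ (p + s + r * l - 1 - δ).toNat = 1 ∧
    B ^ (p + s + r * l - 1 - δ).toNat = 1 := by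
  have hrl : 1 ≤ r * l := one_le_mul_of_one_le_of_one_le hr hl
  have hsl : 0 ≤ s * l := by positivity
  have hN : 0 ≤ p + s + r * l - 1 - δ := by omega
  lift A to ℂˣ using hA.isUnit
  lift B to ℂˣ using hB.isUnit
  norm_cast at h1 h2 ⊢
  simp only [Units.val_eq_one]
  rw [← zpow_natCast, ← zpow_natCast, Int.toNat_of_nonneg (by omega),
    Int.toNat_of_nonneg (by omega)] at h1 h2
  rw [← zpow_natCast, ← zpow_natCast, Int.toNat_of_nonneg hN]
  have hX : A ^ r * B ^ (s - 1) = 1 := by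
    rw [zpow_sub_one, ← mul_assoc, ← h1, mul_inv_cancel]
  have hY : A ^ (p + r * l - 1) * B ^ (q + s * l) = 1 := by
    rw [zpow_sub_one, mul_right_comm, ← h2, mul_inv_cancel]
  have hdet : p + s + r * l - 1 - δ = r * (q + s * l) - (s - 1) * (p + r * l - 1) := by
    rw [hδ]; ring
  refine ⟨hdet ▸ zpow_det_eq_one hX hY, ?_⟩
  rw [mul_comm] at hX hY
  rw [hdet, mul_comm r, mul_comm (s - 1)]
  exact zpow_det_eq_one hY hX
end

section
/- Assume (H). Let A, B be nonzero complex numbers with B = A^r · B^s and A = A^{p+r·l} · B^{q+s·l}. Let a₀ ∈ ℂ \ {0}, a₁, …, a_{l−1}, a' ∈ ℂ, and let G be the first-form germ with coefficients (a₀, …, a_{l−1}, a'). Define a'ᵢ := B^{i+1}·aᵢ/A for i = 0, …, l−1 and a'' := B^{l+K+1}·a'/A, and let G' be the first-form germ with coefficients (a'₀, …, a'_{l−1}, a''). Then for all z = (z₁, z₂) ∈ ℂ²: G(A·z₁, B·z₂) = (A·G'₁(z₁,z₂), B·G'₂(z₁,z₂)); that is, φ_{A,B}⁻¹ ∘ G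 ∘ φ_{A,B} = G' where φ_{A,B}(z₁,z₂) = (A z₁, B z₂). -/
noncomputable section

/-- First-form germ
`G(z₁,z₂) = (z₁^{p+rl} z₂^{q+sl} + Σ_{i=0}^{l−1} aᵢ (z₁^r z₂^s)^{i+1}
            + a' (z₁^r z₂^s)^{l+K+1}, z₁^r z₂^s)`. -/
def Gfirst (p q r s l K : ℤ) (a : ℕ → ℂ) (a' : ℂ) : ℂ × ℂ → ℂ × ℂ := fun z =>
  (z.1 ^ (p + r * l).toNat * z.2 ^ (q + s * l).toNat
      + (∑ i ∈ Finset.range l.toNat, a i * (z.1 ^ r.toNat * z.2 ^ s.toNat) ^ (i + 1))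
      + a' * (z.1 ^ r.toNat * z.2 ^ s.toNat) ^ (l + K + 1).toNat,
   z.1 ^ r.toNat * z.2 ^ s.toNat)

/-- the action of the diagonal linear map `φ_{A,B}` on the family
of first-form germs: `φ_{A,B}⁻¹ ∘ G ∘ φ_{A,B} = G'` where `G'` has coefficients
`a'ᵢ = B^{i+1} aᵢ / A` and `a'' = B^{l+K+1} a' / A`. -/
theorem diagonal_conjugation_of_first_form_germ
    (p q r s l δ K : ℤ)
    (hp : 0 ≤ p) (hq : 0 ≤ q) (hr : 1 ≤ r) (hs : 1 ≤ s) (hl : 1 ≤ l)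
    (hδ : δ = p * s - q * r) (hδ1 : δ = 1 ∨ δ = -1) (hpq : p + q < r + s)
    (hK : K = max 0 ((l - ((r + s) - (p + q))).fdiv (r + s - 1)))
    (A B : ℂ) (hA : A ≠ 0) (hB : B ≠ 0)
    (h1 : B = A ^ r.toNat * B ^ s.toNat)
    (h2 : A = A ^ (p + r * l).toNat * B ^ (q + s * l).toNat)
    (a : ℕ → ℂ) (ha0 : a 0 ≠ 0) (a' : ℂ) :
    ∀ z : ℂ × ℂ,
      Gfirst p q r s l K a a' (A * z.1, B * z.2)
        = (A * (Gfirst p q r s l K (fun i => B ^ (i + 1) * a i / A)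
              (B ^ (l + K + 1).toNat * a' / A) z).1,
           B * (Gfirst p q r s l K (fun i => B ^ (i + 1) * a i / A)
              (B ^ (l + K + 1).toNat * a' / A) z).2) := by
  intro z
  have hmono : (A * z.1) ^ r.toNat * (B * z.2) ^ s.toNat
      = B * (z.1 ^ r.toNat * z.2 ^ s.toNat) := by
    rw [mul_pow, mul_pow]
    linear_combination (-(z.1 ^ r.toNat * z.2 ^ s.toNat)) * h1
  have hlead : (A * z.1) ^ (p + r * l).toNat * (B * z.2) ^ (q + s * l).toNat
      = A * (z.1 ^ (p + r * l).toNat * z.2 ^ (q + s * l).toNat) := by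
    rw [mul_pow, mul_pow]
    linear_combination (-(z.1 ^ (p + r * l).toNat * z.2 ^ (q + s * l).toNat)) * h2
  simp only [Gfirst, hmono, hlead, Prod.mk.injEq, and_true, mul_add, Finset.mul_sum]
  congr 1
  · congr 1
    refine Finset.sum_congr rfl fun i _ => ?_
    rw [mul_pow]
    field_simp
  · rw [mul_pow]
    field_simp
end
end

section
/- Assume (H). Let a₀ ∈ ℂ \ {0}, a₁, …, a_{l−1}, a' ∈ ℂ, and let G be the first-form germ with these coefficients. Then for every z = (z₁, z₂) ∈ ℂ², the determinant of the (Fréchet) derivative of G at z equals (p·s − q·r) · z₁^{p+r(l+1)−1} · z₂^{q+s(l+1)−1}. -/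
noncomputable section

/-- A linear map on `𝕜 × 𝕜` given by four coefficients has the usual determinant. -/
theorem det_eq_of_apply_prod {R : Type*} [CommRing R] (f : R × R →ₗ[R] R × R) :
    LinearMap.det f =
      (f (1, 0)).1 * (f (0, 1)).2 - (f (0, 1)).1 * (f (1, 0)).2 := by
  rw [← LinearMap.det_toMatrix (Module.Basis.finTwoProd R), Matrix.det_fin_two]
  simp [LinearMap.toMatrix_apply]

/-- The derivative of the monomial `z₁^(m+1) z₂^(n+1)`. -/
theorem hasFDerivAt_monomial_prod {𝕜 : Type*} [NontriviallyNormedField 𝕜] (m n : ℕ)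
    (z : 𝕜 × 𝕜) :
    HasFDerivAt (fun w : 𝕜 × 𝕜 => w.1 ^ (m + 1) * w.2 ^ (n + 1))
      (((m + 1) * z.1 ^ m * z.2 ^ (n + 1)) • ContinuousLinearMap.fst 𝕜 𝕜 𝕜 +
        ((n + 1) * z.1 ^ (m + 1) * z.2 ^ n) • ContinuousLinearMap.snd 𝕜 𝕜 𝕜) z := by
  have h₁ := (hasFDerivAt_fst (𝕜 := 𝕜) (p := z)).pow (m + 1)
  have h₂ := (hasFDerivAt_snd (𝕜 := 𝕜) (p := z)).pow (n + 1)
  refine (h₁.mul h₂).congr_fderiv ?_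
  ext <;> simp <;> ring

/-- The Jacobian determinant of `(u + g ∘ v, v)`, for monomials `u` and `v`, does not depend
on `g`. -/
theorem det_fderiv_monomial_add_comp {𝕜 : Type*} [NontriviallyNormedField 𝕜] (m n j k : ℕ)
    {g : 𝕜 → 𝕜} (hg : Differentiable 𝕜 g) (z : 𝕜 × 𝕜) :
    LinearMap.det (fderiv 𝕜 (fun w : 𝕜 × 𝕜 =>
        (w.1 ^ (m + 1) * w.2 ^ (n + 1) + g (w.1 ^ (j + 1) * w.2 ^ (k + 1)),
          w.1 ^ (j + 1) * w.2 ^ (k + 1))) z).toLinearMap =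
      ((m + 1) * (k + 1) - (n + 1) * (j + 1)) * z.1 ^ (m + j + 1) * z.2 ^ (n + k + 1) := by
  have hu := hasFDerivAt_monomial_prod m n z
  have hv := hasFDerivAt_monomial_prod j k z
  have hgv := (hg (z.1 ^ (j + 1) * z.2 ^ (k + 1))).hasDerivAt.comp_hasFDerivAt z hv
  have h := (hu.add hgv).prodMk hv
  have h' := h.fderiv
  simp only [Pi.add_def, Function.comp_def] at h'
  rw [h', det_eq_of_apply_prod]
  simp
  ring

/-- the Jacobian determinant of the first-form germ:
`det DG(z) = (ps - qr) z₁^{p+r(l+1)-1} z₂^{q+s(l+1)-1}`. -/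
theorem det_fderiv_first_form_germ
    (p q r s l δ K : ℤ)
    (hp : 0 ≤ p) (hq : 0 ≤ q) (hr : 1 ≤ r) (hs : 1 ≤ s) (hl : 1 ≤ l)
    (hδ : δ = p * s - q * r) (hδ1 : δ = 1 ∨ δ = -1) (hpq : p + q < r + s)
    (hK : K = max 0 ((l - ((r + s) - (p + q))).fdiv (r + s - 1)))
    (a : ℕ → ℂ) (ha0 : a 0 ≠ 0) (a' : ℂ) (z : ℂ × ℂ) :
    LinearMap.det (fderiv ℂ (Gfirst p q r s l K a a') z).toLinearMap
      = ((p * s - q * r : ℤ) : ℂ) * z.1 ^ (p + r * (l + 1) - 1).toNat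
          * z.2 ^ (q + s * (l + 1) - 1).toNat := by
  obtain ⟨m, hm⟩ : ∃ m : ℕ, p + r * l = m + 1 :=
    ⟨(p + r * l - 1).toNat, by have := one_le_mul_of_one_le_of_one_le hr hl; omega⟩
  obtain ⟨n, hn⟩ : ∃ n : ℕ, q + s * l = n + 1 :=
    ⟨(q + s * l - 1).toNat, by have := one_le_mul_of_one_le_of_one_le hs hl; omega⟩
  obtain ⟨j, rfl⟩ : ∃ j : ℕ, r = j + 1 := ⟨(r - 1).toNat, by omega⟩
  obtain ⟨k, rfl⟩ : ∃ k : ℕ, s = k + 1 := ⟨(s - 1).toNat, by omega⟩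
  have hm' : (p + (j + 1) * (l + 1) - 1).toNat = m + j + 1 := by
    rw [show p + (j + 1) * (l + 1) - 1 = ((m + j + 1 : ℕ) : ℤ) by push_cast; linarith]
    exact Int.toNat_natCast _
  have hn' : (q + (k + 1) * (l + 1) - 1).toNat = n + k + 1 := by
    rw [show q + (k + 1) * (l + 1) - 1 = ((n + k + 1 : ℕ) : ℤ) by push_cast; linarith]
    exact Int.toNat_natCast _
  have hdet : p * (k + 1) - q * (j + 1) = (m + 1) * (k + 1) - (n + 1) * (j + 1) := by
    rw [← hm, ← hn]; ring
  have hg : Differentiable ℂ fun t : ℂ =>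
      (∑ i ∈ Finset.range l.toNat, a i * t ^ (i + 1)) + a' * t ^ (l + K + 1).toNat := by
    fun_prop
  have hG : Gfirst p q (j + 1) (k + 1) l K a a' = fun w : ℂ × ℂ =>
      (w.1 ^ (m + 1) * w.2 ^ (n + 1) +
        ((∑ i ∈ Finset.range l.toNat, a i * (w.1 ^ (j + 1) * w.2 ^ (k + 1)) ^ (i + 1)) +
          a' * (w.1 ^ (j + 1) * w.2 ^ (k + 1)) ^ (l + K + 1).toNat),
        w.1 ^ (j + 1) * w.2 ^ (k + 1)) := by
    have cast_succ_toNat (i : ℕ) : ((i : ℤ) + 1).toNat = i + 1 := by omega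
    funext w
    simp only [Gfirst, hm, hn, cast_succ_toNat, add_assoc]
  rw [hG, hm', hn', hdet]
  refine (det_fderiv_monomial_add_comp m n j k hg z).trans ?_
  push_cast
  rfl
end
end

section
/- Assume (H). Let a₀ ∈ ℂ \ {0}, a₁, …, a_{l−1}, a' ∈ ℂ, set P(z₁,z₂) := z₁ z₂^l + Σ_{i=0}^{l−1} aᵢ z₂^{i+1} + a' z₂^{l+K+1}, and let G(z₁,z₂) = (P(z₁,z₂)^p z₂^q, P(z₁,z₂)^r z₂^s) be the generic-form germ. Then for every z = (z₁, z₂) ∈ ℂ², the determinant of the (Fréchet) derivative of G at z equals (p·s − q·r) · P(z₁,z₂)^{p+r−1} · z₂^{l+q+s−1}. -/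
noncomputable section

/-- `P(z₁,z₂) = z₁ z₂^l + Σ_{i=0}^{l−1} aᵢ z₂^{i+1} + a' z₂^{l+K+1}`. -/
def Pgen (l K : ℤ) (a : ℕ → ℂ) (a' : ℂ) (z : ℂ × ℂ) : ℂ :=
  z.1 * z.2 ^ l.toNat + (∑ i ∈ Finset.range l.toNat, a i * z.2 ^ (i + 1))
    + a' * z.2 ^ (l + K + 1).toNat

/-- Generic-form germ `G(z₁,z₂) = (P^p z₂^q, P^r z₂^s)`. -/
def Ggen (p q r s l K : ℤ) (a : ℕ → ℂ) (a' : ℂ) : ℂ × ℂ → ℂ × ℂ := fun z =>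
  (Pgen l K a a' z ^ p.toNat * z.2 ^ q.toNat,
   Pgen l K a a' z ^ r.toNat * z.2 ^ s.toNat)

open ContinuousLinearMap in
/-- The determinant of the endomorphism of `ℂ × ℂ` with matrix rows `(a, b)` and `(c, d)`. -/
theorem det_prod_fst_snd (a b c d : ℂ) :
    LinearMap.det ((a • fst ℂ ℂ ℂ + b • snd ℂ ℂ ℂ).prod
      (c • fst ℂ ℂ ℂ + d • snd ℂ ℂ ℂ)).toLinearMap = a * d - b * c := by
  rw [← LinearMap.det_toMatrix (Module.Basis.finTwoProd ℂ), Matrix.det_fin_two]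
  simp [LinearMap.toMatrix_apply]

open ContinuousLinearMap in
theorem hasFDerivAt_monomial (m n : ℕ) (w : ℂ × ℂ) :
    HasFDerivAt (fun w : ℂ × ℂ => w.1 ^ m * w.2 ^ n)
      ((m * w.1 ^ (m - 1) * w.2 ^ n) • fst ℂ ℂ ℂ
        + (n * w.1 ^ m * w.2 ^ (n - 1)) • snd ℂ ℂ ℂ) w := by
  refine (((hasFDerivAt_fst (𝕜 := ℂ) (p := w)).pow m).mul
    ((hasFDerivAt_snd (𝕜 := ℂ) (p := w)).pow n)).congr_fderiv ?_
  ext <;> simp <;> ring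

open ContinuousLinearMap in
/-- The partial derivative of `Pgen` in the first variable is `z.2 ^ l`. -/
theorem exists_hasFDerivAt_Pgen (l K : ℤ) (a : ℕ → ℂ) (a' : ℂ) (z : ℂ × ℂ) :
    ∃ c : ℂ, HasFDerivAt (Pgen l K a a')
      (z.2 ^ l.toNat • fst ℂ ℂ ℂ + c • snd ℂ ℂ ℂ) z := by
  have hh : DifferentiableAt ℂ (fun t : ℂ => (∑ i ∈ Finset.range l.toNat, a i * t ^ (i + 1))
      + a' * t ^ (l + K + 1).toNat) z.2 := by fun_prop
  have h := (hasFDerivAt_monomial 1 l.toNat z).add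
    (hh.hasDerivAt.comp_hasFDerivAt z hasFDerivAt_snd)
  simp only [Nat.cast_one, tsub_self, pow_zero, mul_one, one_mul, add_assoc, ← add_smul] at h
  exact ⟨_, h.congr_of_eventuallyEq (.of_forall fun w => by simp [Pgen, add_assoc])⟩

/-- The Jacobian determinant of `(u, v) ↦ (u ^ p * v ^ q, u ^ r * v ^ s)`, expanded. -/
theorem monomial_det_identity {p q r s : ℕ} (hr : 1 ≤ r) (hs : 1 ≤ s) (u v : ℂ) :
    (p * u ^ (p - 1) * v ^ q) * (s * u ^ r * v ^ (s - 1))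
        - (q * u ^ p * v ^ (q - 1)) * (r * u ^ (r - 1) * v ^ s)
      = (p * s - q * r) * u ^ (p + r - 1) * v ^ (q + s - 1) := by
  obtain ⟨r, rfl⟩ := Nat.exists_eq_add_of_le' hr
  obtain ⟨s, rfl⟩ := Nat.exists_eq_add_of_le' hs
  rcases p with _ | p <;> rcases q with _ | q <;>
    simp [← add_assoc, Nat.add_right_comm _ 1] <;> ring

/-- the Jacobian determinant of the generic-form germ:
`det DG(z) = (ps - qr) P(z)^{p+r-1} z₂^{l+q+s-1}`. -/
theorem det_fderiv_generic_form_germ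
    (p q r s l δ K : ℤ)
    (hp : 0 ≤ p) (hq : 0 ≤ q) (hr : 1 ≤ r) (hs : 1 ≤ s) (hl : 1 ≤ l)
    (hδ : δ = p * s - q * r) (hδ1 : δ = 1 ∨ δ = -1) (hpq : p + q < r + s)
    (hK : K = max 0 ((l - ((r + s) - (p + q))).fdiv (r + s - 1)))
    (a : ℕ → ℂ) (ha0 : a 0 ≠ 0) (a' : ℂ) (z : ℂ × ℂ) :
    LinearMap.det (fderiv ℂ (Ggen p q r s l K a a') z).toLinearMap
      = ((p * s - q * r : ℤ) : ℂ) * Pgen l K a a' z ^ (p + r - 1).toNat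
          * z.2 ^ (l + q + s - 1).toNat := by
  obtain ⟨c, hc⟩ := exists_hasFDerivAt_Pgen l K a a' z
  have hG := ((hasFDerivAt_monomial p.toNat q.toNat (Pgen l K a a' z, z.2)).prodMk
    (hasFDerivAt_monomial r.toNat s.toNat (Pgen l K a a' z, z.2))).comp z
      (hc.prodMk hasFDerivAt_snd)
  have hsnd : ContinuousLinearMap.snd ℂ ℂ ℂ
      = (0 : ℂ) • ContinuousLinearMap.fst ℂ ℂ ℂ + (1 : ℂ) • ContinuousLinearMap.snd ℂ ℂ ℂ := by
    ext <;> simp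
  have hP := det_prod_fst_snd (z.2 ^ l.toNat) c 0 1
  rw [← hsnd] at hP
  have hG' : HasFDerivAt (Ggen p q r s l K a a') _ z := hG
  rw [hG'.fderiv, ContinuousLinearMap.toLinearMap_comp, LinearMap.det_comp, hP,
    det_prod_fst_snd, monomial_det_identity (by lia) (by lia)]
  lift p to ℕ using hp
  lift q to ℕ using hq
  lift r to ℕ using by lia
  lift s to ℕ using by lia
  lift l to ℕ using by lia
  have hpr : ((p : ℤ) + r - 1).toNat = p + r - 1 := by lia
  have hlqs : ((l : ℤ) + q + s - 1).toNat = l + (q + s - 1) := by lia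
  rw [hpr, hlqs, pow_add]
  push_cast [Int.toNat_natCast]
  ring
end
end

section
/- Assume (H). Let a₀ ∈ ℂ \ {0}, a₁, …, a_{l−1}, a' ∈ ℂ, and let G be the generic-form germ with these coefficients. Let λ, c ∈ ℂ and b_{p+q}, …, b_{𝔰} ∈ ℂ with b_{p+q} = 1, and let F be the corresponding Favre germ. Suppose φ = (φ₁, φ₂) is complex-analytic on a neighborhood of 0 ∈ ℂ² with φ(0) = 0, and that φ₂(z₁,z₂) = C·z₂·(1 + μ(z₁,z₂)) where C ∈ ℂ \ {0} and μ is analytic near 0 with μ(0) = 0. If F ∘ φ = φ ∘ G on a neighborhood of 0, then C^{r+s−1} = a₀^r and λ·(r+s)·C^{𝔰}·a₀ = (p·s − q·r)·a₀^p. -/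
noncomputable section

/-- Favre germ `F(z₁,z₂) = (λ z₁ z₂^𝔰 + Σ_{i=p+q}^{𝔰} bᵢ z₂^i + c z₂^e, z₂^k)`. -/
def Favre (pqN sN kN eN : ℕ) (lam c : ℂ) (b : ℕ → ℂ) : ℂ × ℂ → ℂ × ℂ := fun z =>
  (lam * z.1 * z.2 ^ sN + (∑ i ∈ Finset.Icc pqN sN, b i * z.2 ^ i) + c * z.2 ^ eN,
   z.2 ^ kN)

open Filter Topology in
theorem eventually_hasDerivAt_slice {f : ℂ × ℂ → ℂ} (hf : AnalyticAt ℂ f 0) :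
    ∀ᶠ y : ℂ in 𝓝 0, HasDerivAt (fun t : ℂ => f (t, y)) (fderiv ℂ f (0, y) (1, 0)) 0 := by
  have hy : Tendsto (fun y : ℂ => ((0 : ℂ), y)) (𝓝 0) (𝓝 0) := by
    have : Continuous (fun y : ℂ => ((0 : ℂ), y)) := by fun_prop
    exact this.tendsto' 0 0 rfl
  filter_upwards [hy.eventually hf.eventually_analyticAt] with y hy
  exact hy.differentiableAt.hasFDerivAt.comp_hasDerivAt (0 : ℂ)
    ((hasDerivAt_id (0 : ℂ)).prodMk (hasDerivAt_const (0 : ℂ) y))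

/-- The germ `(z₂ⁿ Uᵖ, z₂ᵏ Uʳ)` with `U = z₁ z₂ᵐ + u(z₂)`. -/
def factoredGerm (p r m n k : ℕ) (u : ℂ → ℂ) (z : ℂ × ℂ) : ℂ × ℂ :=
  (z.2 ^ n * (z.1 * z.2 ^ m + u z.2) ^ p, z.2 ^ k * (z.1 * z.2 ^ m + u z.2) ^ r)

open Filter Topology in
theorem tendsto_factoredGerm_slice (p r m : ℕ) {n k : ℕ} (hn : n ≠ 0) (hk : k ≠ 0) {u : ℂ → ℂ}
    (hu : ContinuousAt u 0) :
    Tendsto (fun y => factoredGerm p r m n k u (0, y)) (𝓝 0) (𝓝 0) := by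
  have : ContinuousAt (fun y => factoredGerm p r m n k u (0, y)) 0 := by
    unfold factoredGerm
    simp only [zero_mul, zero_add]
    fun_prop
  have h0 : factoredGerm p r m n k u (0, 0) = 0 := by simp [factoredGerm, hn, hk]
  exact h0 ▸ this.tendsto

open Filter Topology in
theorem eventually_hasDerivAt_comp_factoredGerm (p r m : ℕ) {n k : ℕ} (hn : n ≠ 0) (hk : k ≠ 0)
    {u : ℂ → ℂ} (hu : ContinuousAt u 0) {f : ℂ × ℂ → ℂ} (hf : AnalyticAt ℂ f 0) :
    ∀ᶠ y : ℂ in 𝓝 0, HasDerivAt (fun t : ℂ => f (factoredGerm p r m n k u (t, y)))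
      (y ^ m * fderiv ℂ f (factoredGerm p r m n k u (0, y))
        (y ^ n * (p * u y ^ (p - 1)), y ^ k * (r * u y ^ (r - 1)))) 0 := by
  filter_upwards [(tendsto_factoredGerm_slice p r m hn hk hu).eventually hf.eventually_analyticAt]
    with y hy
  have hU : HasDerivAt (fun t : ℂ => t * y ^ m + u y) (y ^ m) 0 := by
    simpa using ((hasDerivAt_id (0 : ℂ)).mul_const (y ^ m)).add_const (u y)
  have hG := ((hU.pow p).const_mul (y ^ n)).prodMk ((hU.pow r).const_mul (y ^ k))
  have := hy.differentiableAt.hasFDerivAt.comp_hasDerivAt (0 : ℂ) hG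
  refine this.congr_deriv ?_
  rw [← smul_eq_mul (y ^ m), ← map_smul]
  congr 1
  simp only [Prod.smul_mk, smul_eq_mul, zero_mul, zero_add]
  ext <;> ring

open Filter Topology Polynomial in
theorem multipliers_of_conjugation {p r m n k : ℕ} (hr : 1 ≤ r) (hn : 1 ≤ n) (hnk : n < k)
    {a₀ lam C : ℂ} (ha₀ : a₀ ≠ 0) (hC : C ≠ 0)
    {u : ℂ → ℂ} (hu : ContinuousAt u 0) (hu0 : u 0 = a₀) {h : ℂ[X]} (hh : h.eval 0 = 1)
    {φ w : ℂ × ℂ → ℂ} (hφ : AnalyticAt ℂ φ 0) (hw : AnalyticAt ℂ w 0)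
    (hφ0 : φ 0 = 0) (hw0 : w 0 = 1)
    (hfst : ∀ᶠ z : ℂ × ℂ in 𝓝 0,
      lam * φ z * (C * z.2 * w z) ^ (n + m) + (C * z.2 * w z) ^ n * h.eval (C * z.2 * w z)
        = φ (factoredGerm p r m n k u z))
    (hsnd : ∀ᶠ z : ℂ × ℂ in 𝓝 0, (C * z.2 * w z) ^ k
        = C * (factoredGerm p r m n k u z).2 * w (factoredGerm p r m n k u z)) :
    C ^ (k - 1) = a₀ ^ r ∧ lam * k * C ^ (n + m) * a₀ = (p * k - n * r) * a₀ ^ p := by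
  have hn0 : n ≠ 0 := by omega
  have hk0 : k ≠ 0 := by omega
  set G := factoredGerm p r m n k u with hGdef
  have hι : Tendsto (fun y : ℂ => ((0 : ℂ), y)) (𝓝 0) (𝓝 0) := by
    have : Continuous (fun y : ℂ => ((0 : ℂ), y)) := by fun_prop
    exact this.tendsto' 0 0 rfl
  have hle : 𝓝[≠] (0 : ℂ) ≤ 𝓝 0 := nhdsWithin_le_nhds
  have slice : ∀ {Q : ℂ × ℂ → Prop}, (∀ᶠ z in 𝓝 0, Q z) →
      ∀ᶠ y : ℂ in 𝓝[≠] 0, ∀ᶠ t : ℂ in 𝓝 0, Q (t, y) := by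
    intro Q hQ
    filter_upwards [hle (hι.eventually hQ.eventually_nhds)] with y hy
    have : Continuous (fun t : ℂ => (t, y)) := by fun_prop
    exact (this.tendsto 0).eventually hy
  have hG : Tendsto (fun y => G (0, y)) (𝓝[≠] 0) (𝓝 0) :=
    (tendsto_factoredGerm_slice p r m hn0 hk0 hu).mono_left hle
  have hι' := hι.mono_left hle
  have ty : Tendsto (fun y : ℂ => y) (𝓝[≠] 0) (𝓝 0) := tendsto_id.mono_left hle
  have tu : Tendsto u (𝓝[≠] 0) (𝓝 a₀) := hu0 ▸ hu.tendsto.mono_left hle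
  have tw : Tendsto (fun y => w (0, y)) (𝓝[≠] 0) (𝓝 1) :=
    hw0 ▸ hw.continuousAt.tendsto.comp hι'
  have tφ : Tendsto (fun y => φ (0, y)) (𝓝[≠] 0) (𝓝 0) := by
    have := hφ.continuousAt.tendsto.comp hι'
    rwa [hφ0] at this
  have twG : Tendsto (fun y => w (G (0, y))) (𝓝[≠] 0) (𝓝 1) :=
    hw0 ▸ hw.continuousAt.tendsto.comp hG
  have apply_clm : ∀ {L : ℂ → ℂ × ℂ →L[ℂ] ℂ} {v : ℂ → ℂ × ℂ} {L₀ : ℂ × ℂ →L[ℂ] ℂ} {v₀ : ℂ × ℂ},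
      Tendsto L (𝓝[≠] 0) (𝓝 L₀) → Tendsto v (𝓝[≠] 0) (𝓝 v₀) →
      Tendsto (fun y => L y (v y)) (𝓝[≠] 0) (𝓝 (L₀ v₀)) := fun {_ _ L₀ v₀} hL hv =>
    ((continuous_fst.clm_apply continuous_snd).tendsto (L₀, v₀)).comp (hL.prodMk_nhds hv)
  have tdw : Tendsto (fun y => fderiv ℂ w (G (0, y))) (𝓝[≠] 0) (𝓝 (fderiv ℂ w 0)) :=
    hw.fderiv.continuousAt.tendsto.comp hG
  have tdφ : Tendsto (fun y => fderiv ℂ φ (G (0, y))) (𝓝[≠] 0) (𝓝 (fderiv ℂ φ 0)) :=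
    hφ.fderiv.continuousAt.tendsto.comp hG
  have tφt : Tendsto (fun y => fderiv ℂ φ (0, y) (1, 0)) (𝓝[≠] 0)
      (𝓝 (fderiv ℂ φ 0 (1, 0))) :=
    apply_clm (hφ.fderiv.continuousAt.tendsto.comp hι') tendsto_const_nhds
  have typ : ∀ {j : ℕ}, j ≠ 0 → Tendsto (fun y : ℂ => y ^ j) (𝓝[≠] 0) (𝓝 0) := by
    intro j hj
    simpa [hj] using ty.pow j
  set α := fderiv ℂ φ 0 (1, 0) with hα
  have tx : Tendsto (fun y => C * y * w (0, y)) (𝓝[≠] 0) (𝓝 0) := by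
    simpa using (ty.const_mul C).mul tw
  have th : Tendsto (fun y => h.eval (C * y * w (0, y))) (𝓝[≠] 0) (𝓝 1) :=
    hh ▸ (h.continuous.tendsto 0).comp tx
  have th' : Tendsto (fun y => h.derivative.eval (C * y * w (0, y))) (𝓝[≠] 0)
      (𝓝 (h.derivative.eval 0)) :=
    (h.derivative.continuous.tendsto 0).comp tx
  -- the leading coefficient of the second component
  have hCk : C ^ k = C * a₀ ^ r := by
    refine tendsto_nhds_unique_of_eventuallyEq (l := 𝓝[≠] (0 : ℂ))
      (f := fun y => C ^ k * w (0, y) ^ k) (g := fun y => C * u y ^ r * w (G (0, y))) ?_ ?_ ?_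
    · simpa using (tw.pow k).const_mul (C ^ k)
    · simpa using ((tu.pow r).const_mul C).mul twG
    · filter_upwards [hle (hι.eventually hsnd), self_mem_nhdsWithin] with y hy hy0
      have hy0 : y ≠ 0 := hy0
      apply mul_left_cancel₀ (pow_ne_zero k hy0)
      have : (G (0, y)).2 = y ^ k * u y ^ r := by simp [hGdef, factoredGerm]
      rw [this] at hy
      linear_combination hy
  -- the leading coefficient of the first component
  have hα0 : C ^ n = α * a₀ ^ p := by
    refine tendsto_nhds_unique_of_eventuallyEq (l := 𝓝[≠] (0 : ℂ))
      (f := fun y => lam * φ (0, y) * C ^ (n + m) * y ^ m * w (0, y) ^ (n + m)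
        + C ^ n * w (0, y) ^ n * h.eval (C * y * w (0, y)))
      (g := fun y => (y ^ n)⁻¹ * φ (G (0, y))) ?_ ?_ ?_
    · simpa using (((((tφ.const_mul lam).mul_const (C ^ (n + m))).mul (ty.pow m)).mul
        (tw.pow (n + m))).add (((tw.pow n).const_mul (C ^ n)).mul th))
    · have hv : Tendsto (fun y : ℂ => (y ^ n)⁻¹ • G (0, y)) (𝓝[≠] 0) (𝓝 (a₀ ^ p, 0)) := by
        have : Tendsto (fun y : ℂ => (u y ^ p, y ^ (k - n) * u y ^ r)) (𝓝[≠] 0)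
            (𝓝 (a₀ ^ p, 0)) := by
          refine (tu.pow p).prodMk_nhds ?_
          simpa using (typ (show k - n ≠ 0 by omega)).mul (tu.pow r)
        refine this.congr' ?_
        filter_upwards [self_mem_nhdsWithin] with y hy0
        have hy0 : y ≠ 0 := hy0
        have hyk : y ^ k = y ^ n * y ^ (k - n) := by rw [← pow_add]; congr 1; omega
        simp only [hGdef, factoredGerm, Prod.smul_mk, smul_eq_mul, zero_mul, zero_add, hyk]
        have := pow_ne_zero n hy0
        ext <;> field_simp
      have := hφ.differentiableAt.hasFDerivAt.hasFDerivWithinAt (s := Set.univ) |>.lim hG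
        (Eventually.of_forall fun _ => Set.mem_univ _) hv
      simp only [zero_add, hφ0, sub_zero, smul_eq_mul] at this
      convert this using 2
      rw [show ((a₀ ^ p, 0) : ℂ × ℂ) = a₀ ^ p • ((1 : ℂ), (0 : ℂ)) by simp, map_smul, smul_eq_mul,
        mul_comm]
    · filter_upwards [hle (hι.eventually hfst), self_mem_nhdsWithin] with y hy hy0
      have hy0 : y ≠ 0 := hy0
      rw [← hy]
      have := pow_ne_zero n hy0
      field_simp
      ring
  have hαne : α ≠ 0 := by
    rintro h0
    rw [h0, zero_mul] at hα0
    exact pow_ne_zero n hC hα0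
  have tA : Tendsto (fun y => fderiv ℂ w (G (0, y))
      (y ^ n * (p * u y ^ (p - 1)), y ^ k * (r * u y ^ (r - 1)))) (𝓝[≠] 0) (𝓝 0) := by
    have : Tendsto (fun y => (y ^ n * (p * u y ^ (p - 1)), y ^ k * (r * u y ^ (r - 1))))
        (𝓝[≠] 0) (𝓝 ((0 : ℂ), (0 : ℂ))) := by
      refine Tendsto.prodMk_nhds ?_ ?_
      · simpa using (typ hn0).mul ((tu.pow (p - 1)).const_mul (p : ℂ))
      · simpa using (typ hk0).mul ((tu.pow (r - 1)).const_mul (r : ℂ))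
    have := apply_clm tdw this
    rwa [Prod.mk_zero_zero, map_zero] at this
  have tB : Tendsto (fun y => fderiv ℂ φ (G (0, y))
      (p * u y ^ (p - 1), y ^ (k - n) * (r * u y ^ (r - 1)))) (𝓝[≠] 0)
      (𝓝 (α * (p * a₀ ^ (p - 1)))) := by
    have : Tendsto (fun y => (p * u y ^ (p - 1), y ^ (k - n) * (r * u y ^ (r - 1))))
        (𝓝[≠] 0) (𝓝 (p * a₀ ^ (p - 1), (0 : ℂ))) := by
      refine Tendsto.prodMk_nhds ((tu.pow (p - 1)).const_mul (p : ℂ)) ?_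
      simpa using (typ (show k - n ≠ 0 by omega)).mul ((tu.pow (r - 1)).const_mul (r : ℂ))
    have := apply_clm tdφ this
    rwa [show ((p * a₀ ^ (p - 1), 0) : ℂ × ℂ) = (p * a₀ ^ (p - 1)) • ((1 : ℂ), (0 : ℂ)) by simp,
      map_smul, smul_eq_mul, mul_comm] at this
  -- `∂₁w(0, y) = yᵐ W(y)`
  set W : ℂ → ℂ := fun y => C * (r * u y ^ (r - 1) * w (G (0, y)) + u y ^ r * fderiv ℂ w (G (0, y))
      (y ^ n * (p * u y ^ (p - 1)), y ^ k * (r * u y ^ (r - 1)))) / (C ^ k * (k * w (0, y) ^ (k - 1)))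
    with hW
  have hkC : (k : ℂ) ≠ 0 := Nat.cast_ne_zero.2 hk0
  have tW : Tendsto W (𝓝[≠] 0) (𝓝 (r / (k * a₀))) := by
    have h1 := (((((tu.pow (r - 1)).const_mul (r : ℂ)).mul twG).add ((tu.pow r).mul tA)).const_mul
      C).div (((tw.pow (k - 1)).const_mul (k : ℂ)).const_mul (C ^ k)) (by simp [hC, hkC])
    have har : a₀ ^ r = a₀ ^ (r - 1) * a₀ := by rw [← pow_succ]; congr 1; omega
    have hlim : C * (r * a₀ ^ (r - 1) * 1 + a₀ ^ r * 0) / (C ^ k * (k * 1 ^ (k - 1)))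
        = r / (k * a₀) := by
      have := pow_ne_zero (r - 1) ha₀
      rw [hCk, har, one_pow, mul_zero]
      field_simp
      simp
    exact hlim ▸ h1
  have hwt : ∀ᶠ y : ℂ in 𝓝[≠] 0, HasDerivAt (fun t : ℂ => w (t, y)) (y ^ m * W y) 0 := by
    filter_upwards [slice hsnd, self_mem_nhdsWithin, hle (eventually_hasDerivAt_slice hw),
      hle (eventually_hasDerivAt_comp_factoredGerm p r m hn0 hk0 hu hw),
      tw.eventually_ne one_ne_zero] with y hy hy0 hd hdG hwne
    have hy0 : y ≠ 0 := hy0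
    have hU : HasDerivAt (fun t : ℂ => t * y ^ m + u y) (y ^ m) 0 := by
      simpa using ((hasDerivAt_id (0 : ℂ)).mul_const (y ^ m)).add_const (u y)
    have hR := ((((hU.pow r).const_mul (y ^ k)).const_mul C).mul hdG)
    have hL := (hd.const_mul (C * y)).pow k
    have heq := hL.unique (hR.congr_of_eventuallyEq hy)
    have hyk : y ^ k = y ^ (k - 1) * y := by rw [← pow_succ]; congr 1; omega
    have hCk' : C ^ k = C ^ (k - 1) * C := by rw [← pow_succ]; congr 1; omega
    convert hd using 1
    have h2 := pow_ne_zero (k - 1) hwne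
    simp only [hW]
    rw [← mul_div_assoc, div_eq_iff (by simp [hC, hkC, hwne])]
    apply mul_left_cancel₀ (pow_ne_zero k hy0)
    simp only [Pi.pow_apply, zero_mul, zero_add, mul_pow, ← hGdef] at heq
    rw [hCk', hyk] at *
    linear_combination -heq
  have hmain : lam * C ^ (n + m) * α + C ^ n * (n * (r / (k * a₀))) = α * (p * a₀ ^ (p - 1)) := by
    refine tendsto_nhds_unique_of_eventuallyEq (l := 𝓝[≠] (0 : ℂ))
      (f := fun y => lam * C ^ (n + m) * (fderiv ℂ φ (0, y) (1, 0) * w (0, y) ^ (n + m)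
          + φ (0, y) * ((n + m : ℕ) * w (0, y) ^ (n + m - 1) * (y ^ m * W y)))
        + C ^ n * (n * w (0, y) ^ (n - 1) * W y * h.eval (C * y * w (0, y))
          + w (0, y) ^ n * (h.derivative.eval (C * y * w (0, y)) * (C * y * W y)))) ?_ tB ?_
    · have h1 := ((tφt.mul (tw.pow (n + m))).add (tφ.mul (((tw.pow (n + m - 1)).const_mul
        ((n + m : ℕ) : ℂ)).mul ((ty.pow m).mul tW)))).const_mul (lam * C ^ (n + m))
      have h2 := (((((tw.pow (n - 1)).const_mul (n : ℂ)).mul tW).mul th).add ((tw.pow n).mul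
        (th'.mul ((ty.const_mul C).mul tW)))).const_mul (C ^ n)
      convert h1.add h2 using 2
      simp
    · filter_upwards [slice hfst, self_mem_nhdsWithin, hle (eventually_hasDerivAt_slice hφ), hwt,
        hle (eventually_hasDerivAt_comp_factoredGerm p r m hn0 hk0 hu hφ)] with y hy hy0 hd hdw hdG
      have hy0 : y ≠ 0 := hy0
      have hx := hdw.const_mul (C * y)
      have hL := ((hd.const_mul lam).mul (hx.pow (n + m))).add ((hx.pow n).mul
        ((h.hasDerivAt (C * y * w (0, y))).comp (0 : ℂ) hx))
      have heq := hL.unique (hdG.congr_of_eventuallyEq hy)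
      have hyk : y ^ k = y ^ n * y ^ (k - n) := by rw [← pow_add]; congr 1; omega
      rw [show ((y ^ n * (p * u y ^ (p - 1)), y ^ k * (r * u y ^ (r - 1))) : ℂ × ℂ)
        = y ^ n • (p * u y ^ (p - 1), y ^ (k - n) * (r * u y ^ (r - 1))) by
          simp [hyk, mul_assoc], map_smul, smul_eq_mul, ← hGdef] at heq
      apply mul_left_cancel₀ (mul_ne_zero (pow_ne_zero m hy0) (pow_ne_zero n hy0))
      rw [mul_assoc (y ^ m) (y ^ n) (fderiv ℂ φ (G (0, y)) _), ← heq]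
      obtain ⟨j, rfl⟩ : ∃ j, n = j + 1 := ⟨n - 1, by omega⟩
      simp only [Pi.pow_apply, Function.comp_apply, mul_pow,
        show j + 1 + m - 1 = j + m by omega, Nat.add_sub_cancel]
      push_cast
      ring
  refine ⟨?_, ?_⟩
  · apply mul_left_cancel₀ hC
    rw [← pow_succ', ← hCk]
    congr 1
    omega
  · apply mul_left_cancel₀ hαne
    have hp : (p : ℂ) * a₀ ^ (p - 1) * a₀ = p * a₀ ^ p := by
      rcases p with _ | p
      · simp
      · simp [pow_succ, mul_assoc]
    rw [hα0] at hmain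
    have h3 : (n : ℂ) * (r / (k * a₀)) * (k * a₀) = n * r := by field_simp
    linear_combination (k * a₀) * hmain - α * a₀ ^ p * h3 + α * k * hp

/-- if an analytic local change of coordinates
`φ = (φ₁, C z₂ (1 + μ))` conjugates the generic-form germ `G` to the Favre germ
`F` near `0` (i.e. `F ∘ φ = φ ∘ G`), then `C^{r+s-1} = a₀^r` and
`λ (r+s) C^𝔰 a₀ = (ps - qr) a₀^p`. -/
theorem conjugation_determines_C_and_lambda
    (p q r s l δ K : ℤ)
    (hp : 0 ≤ p) (hq : 0 ≤ q) (hr : 1 ≤ r) (hs : 1 ≤ s) (hl : 1 ≤ l)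
    (hδ : δ = p * s - q * r) (hδ1 : δ = 1 ∨ δ = -1) (hpq : p + q < r + s)
    (hK : K = max 0 ((l - ((r + s) - (p + q))).fdiv (r + s - 1)))
    (a : ℕ → ℂ) (ha0 : a 0 ≠ 0) (a' : ℂ)
    (lam c : ℂ) (b : ℕ → ℂ) (hb : b (p + q).toNat = 1)
    (C : ℂ) (hC : C ≠ 0)
    (φ₁ μ : ℂ × ℂ → ℂ)
    (hφ₁ : AnalyticAt ℂ φ₁ 0) (hμ : AnalyticAt ℂ μ 0)
    (hφ₁0 : φ₁ 0 = 0) (hμ0 : μ 0 = 0)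
    (hconj : ∀ᶠ z : ℂ × ℂ in nhds 0,
      Favre (p + q).toNat (p + q + l - 1).toNat (r + s).toNat ((r + s) * (K + 1)).toNat
          lam c b (φ₁ z, C * z.2 * (1 + μ z))
        = (φ₁ (Ggen p q r s l K a a' z),
           C * (Ggen p q r s l K a a' z).2 * (1 + μ (Ggen p q r s l K a a' z)))) :
    C ^ (r + s - 1).toNat = a 0 ^ r.toNat ∧
    lam * ((r + s : ℤ) : ℂ) * C ^ (p + q + l - 1).toNat * a 0
      = ((p * s - q * r : ℤ) : ℂ) * a 0 ^ p.toNat := by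
  have hK0 : 0 ≤ K := hK ▸ le_max_left _ _
  clear hK
  have hpq1 : 1 ≤ p + q := by
    rcases hp.eq_or_lt with rfl | hp
    · rcases hq.eq_or_lt with rfl | hq
      · simp_all
      · omega
    · omega
  have he : p + q < (r + s) * (K + 1) := by nlinarith
  lift p to ℕ using hp
  lift q to ℕ using hq
  lift r to ℕ using by omega
  lift s to ℕ using by omega
  lift l to ℕ using by omega
  lift K to ℕ using hK0
  obtain ⟨m, rfl⟩ : ∃ m, l = m + 1 := ⟨l - 1, by omega⟩
  rw [show ((p : ℤ) + q + (m + 1 : ℕ) - 1).toNat = p + q + m by omega] at hconj ⊢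
  rw [show ((p : ℤ) + q).toNat = p + q by omega] at hconj hb
  rw [show ((r : ℤ) + s).toNat = r + s by omega,
    show (((r : ℤ) + s) * (K + 1)).toNat = (r + s) * (K + 1) by exact_mod_cast Int.toNat_natCast _]
    at hconj
  have he' : p + q < (r + s) * (K + 1) := by exact_mod_cast he
  rw [show ((r : ℤ) + s - 1).toNat = r + s - 1 by omega, Int.toNat_natCast, Int.toNat_natCast]
  set u : ℂ → ℂ := fun y => (∑ i ∈ Finset.range (m + 1), a i * y ^ i) + a' * y ^ (m + 1 + K) with hu
  have hG : Ggen p q r s (m + 1 : ℕ) K a a' = factoredGerm p r m (p + q) (r + s) u := by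
    funext z
    have hP : Pgen (m + 1 : ℕ) K a a' z = z.2 * (z.1 * z.2 ^ m + u z.2) := by
      simp only [Pgen, hu, show (((m + 1 : ℕ) : ℤ) + K + 1).toNat = m + 1 + K + 1 by omega,
        Int.toNat_natCast, mul_add, Finset.mul_sum, pow_succ]
      rw [Finset.sum_congr rfl fun i _ => show a i * (z.2 ^ i * z.2) = z.2 * (a i * z.2 ^ i) by ring]
      ring
    simp only [Ggen, factoredGerm, hP, Int.toNat_natCast, mul_pow, pow_add]
    ext <;> ring
  rw [hG] at hconj
  have hucont : Continuous u := by fun_prop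
  have hu0 : u 0 = a 0 := by simp [hu, Finset.sum_range_succ']
  let h : Polynomial ℂ := (∑ i ∈ Finset.Icc (p + q) (p + q + m), Polynomial.C (b i) *
    Polynomial.X ^ (i - (p + q))) + Polynomial.C c * Polynomial.X ^ ((r + s) * (K + 1) - (p + q))
  have hh : h.eval 0 = 1 := by
    have hne : (r + s) * (K + 1) - (p + q) ≠ 0 := by omega
    simp only [h, Polynomial.eval_add, Polynomial.eval_finsetSum, Polynomial.eval_mul,
      Polynomial.eval_C, Polynomial.eval_pow, Polynomial.eval_X, zero_pow hne, mul_zero, add_zero]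
    rw [Finset.sum_eq_single_of_mem (p + q) (by simp) fun i hi hne => ?_]
    · simp [hb]
    · rw [zero_pow (by have := (Finset.mem_Icc.1 hi).1; omega), mul_zero]
  have hH : ∀ x : ℂ, x ^ (p + q) * h.eval x = (∑ i ∈ Finset.Icc (p + q) (p + q + m), b i * x ^ i)
      + c * x ^ ((r + s) * (K + 1)) := by
    intro x
    simp only [h, Polynomial.eval_add, Polynomial.eval_finsetSum, Polynomial.eval_mul,
      Polynomial.eval_C, Polynomial.eval_pow, Polynomial.eval_X, mul_add (x ^ (p + q)), Finset.mul_sum]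
    congr 1
    · refine Finset.sum_congr rfl fun i hi => ?_
      rw [mul_left_comm, ← pow_add, Nat.add_sub_cancel' (Finset.mem_Icc.1 hi).1]
    · rw [mul_left_comm, ← pow_add, Nat.add_sub_cancel' he'.le]
  obtain ⟨h₁, h₂⟩ := multipliers_of_conjugation (lam := lam) (m := m) (p := p)
    (r := r) (n := p + q) (k := r + s) (w := fun z => 1 + μ z) (by omega) (by omega) (by omega) ha0 hC hucont.continuousAt
    hu0 hh hφ₁ (analyticAt_const.add hμ) hφ₁0 (by simp [hμ0])
    (by
      filter_upwards [hconj] with z hz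
      have := congrArg Prod.fst hz
      simp only [Favre] at this
      simp only [hH, ← this]
      ring)
    (by
      filter_upwards [hconj] with z hz
      exact congrArg Prod.snd hz)
  refine ⟨h₁, ?_⟩
  push_cast at h₂ ⊢
  linear_combination h₂
end
end

section
/- Assume (H) with moreover p ≥ 1, q ≥ 1, l ≥ 2, and r + s > p + q + 1. Let a₀ ∈ ℂ \ {0}, a₁, …, a_{l−1}, a' ∈ ℂ, and let G be the generic-form germ with these coefficients. Let λ, c ∈ ℂ and b_{p+q}, …, b_{𝔰} ∈ ℂ with b_{p+q} = 1, and let F be the corresponding Favre germ. Suppose φ = (φ₁, φ₂) is complex-analytic on a neighborhood of 0 ∈ ℂ² with φ(0) = 0 and φ₂(z₁,z₂) = C·z₂·(1 + μ(z₁,z₂)), where C ∈ ℂ \ {0} and μ is analytic near 0 with μ(0) = 0, and that F ∘ φ = φ ∘ G on a neighborhood of 0. Then b_{p+q+1}·C·a₀·(r+s) = (p·s − q·r)·a₁. -/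
noncomputable section

open Filter Topology Asymptotics in
theorem HasDerivAt.eq_and_eq_of_eventuallyEq_nhdsNE {f g : ℂ → ℂ} {f' g' x : ℂ}
    (hf : HasDerivAt f f' x) (hg : HasDerivAt g g' x) (h : f =ᶠ[𝓝[≠] x] g) :
    f x = g x ∧ f' = g' := by
  have h' : f =ᶠ[𝓝 x] g :=
    (hf.continuousAt.eventuallyEq_nhds_iff_eventuallyEq_nhdsNE hg.continuousAt).1 h
  exact ⟨h'.eq_of_nhds, hf.unique (hg.congr_of_eventuallyEq h')⟩

theorem hasDerivAt_sum_mul_pow_zero {l : ℕ} (hl : 2 ≤ l) (a : ℕ → ℂ) :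
    HasDerivAt (fun x : ℂ => ∑ i ∈ Finset.range l, a i * x ^ i) (a 1) 0 := by
  have h := HasDerivAt.fun_sum (u := Finset.range l) (A := fun i (x : ℂ) => a i * x ^ i)
    (A' := fun i => a i * (i * 0 ^ (i - 1))) (x := 0)
    (fun i _ => (hasDerivAt_pow i (0 : ℂ)).const_mul (a i))
  refine h.congr_deriv ?_
  rw [Finset.sum_eq_single 1]
  · simp
  · intro i _ hi
    rcases Nat.eq_zero_or_pos i with rfl | h0
    · simp
    · simp [zero_pow (show i - 1 ≠ 0 by omega)]
  · intro h1
    exact absurd (Finset.mem_range.2 (by omega)) h1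

theorem hasDerivAt_sum_mul_pow_add_zero {l e : ℕ} (hl : 2 ≤ l) (he : 2 ≤ e) (a : ℕ → ℂ) (c : ℂ) :
    HasDerivAt (fun x : ℂ => ∑ i ∈ Finset.range l, a i * x ^ i + c * x ^ e) (a 1) 0 := by
  have h := (hasDerivAt_sum_mul_pow_zero hl a).fun_add
    ((hasDerivAt_pow e (0 : ℂ)).const_mul c)
  exact h.congr_deriv (by simp [zero_pow (show e - 1 ≠ 0 by omega)])

theorem sum_mul_pow_add_apply_zero {l e : ℕ} (hl : 2 ≤ l) (he : 2 ≤ e) (a : ℕ → ℂ) (c : ℂ) :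
    ∑ i ∈ Finset.range l, a i * (0 : ℂ) ^ i + c * 0 ^ e = a 0 := by
  rw [Finset.sum_eq_single 0]
  · simp [zero_pow (show e ≠ 0 by omega)]
  · intro i _ hi
    simp [hi]
  · intro h1
    exact absurd (Finset.mem_range.2 (by omega)) h1

open Filter Topology Asymptotics in
theorem AnalyticAt.exists_isBigO_sub_linear {φ : ℂ × ℂ → ℂ} (hφ : AnalyticAt ℂ φ 0)
    (h0 : φ 0 = 0) :
    ∃ α β : ℂ, (fun w : ℂ × ℂ => φ w - (α * w.1 + β * w.2)) =O[𝓝 0] fun w => ‖w‖ ^ 2 := by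
  obtain ⟨P, hP⟩ := hφ
  have h := hP.isBigO_sub_partialSum_pow 2
  let L : (ℂ × ℂ) →L[ℂ] ℂ := continuousMultilinearCurryFin1 ℂ (ℂ × ℂ) ℂ (P 1)
  refine ⟨L (1, 0), L (0, 1), h.congr_left fun w => ?_⟩
  have hw : L w = L (1, 0) * w.1 + L (0, 1) * w.2 := by
    have : w = w.1 • ((1 : ℂ), (0 : ℂ)) + w.2 • ((0 : ℂ), (1 : ℂ)) := by
      ext <;> simp
    conv_lhs => rw [this]
    rw [map_add, map_smul, map_smul]
    simp only [smul_eq_mul]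
    ring
  have h1 : P.partialSum 2 w = L w := by
    have hz : P 0 (fun _ => w) = 0 := by rw [← h0]; exact hP.coeff_zero _
    simp only [FormalMultilinearSeries.partialSum, Finset.sum_range_succ, Finset.sum_range_zero,
      zero_add, hz, L, continuousMultilinearCurryFin1_apply]
    congr 1
  rw [h1, hw, zero_add]

open Filter Topology Asymptotics in
theorem AnalyticAt.exists_hasDerivAt_curve_quotient {φ : ℂ × ℂ → ℂ} (hφ : AnalyticAt ℂ φ 0)
    (h0 : φ 0 = 0) {n k : ℕ} (hn : 2 ≤ n) (hk : n + 2 ≤ k) {x y : ℂ → ℂ}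
    (hx : ContinuousAt x 0) (hy : ContinuousAt y 0) :
    ∃ (α : ℂ) (ρ : ℂ → ℂ), ρ 0 = 0 ∧ HasDerivAt ρ 0 0 ∧
      ∀ t ≠ 0, φ (t ^ n * x t, t ^ k * y t) = t ^ n * (α * x t + ρ t) := by
  obtain ⟨α, β, h⟩ := hφ.exists_isBigO_sub_linear h0
  let γ : ℂ → ℂ × ℂ := fun t => (t ^ n * x t, t ^ k * y t)
  have pow_O : ∀ {i j : ℕ}, i ≤ j → (fun t : ℂ => t ^ j) =O[𝓝 0] fun t : ℂ => t ^ i := by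
    intro i j hij
    rw [← Nat.add_sub_of_le hij]
    have : (fun t : ℂ => t ^ (j - i)) =O[𝓝 0] fun _ => (1 : ℂ) :=
      ((continuous_pow (j - i)).continuousAt).isBigO_one ℂ
    simpa [pow_add] using (isBigO_refl (fun t : ℂ => t ^ i) (𝓝 0)).mul this
  have hxO : (fun t : ℂ => t ^ n * x t) =O[𝓝 0] fun t : ℂ => t ^ n := by
    simpa using (isBigO_refl (fun t : ℂ => t ^ n) (𝓝 0)).mul (hx.isBigO_one ℂ)
  have hyO : (fun t : ℂ => t ^ k * y t) =O[𝓝 0] fun t : ℂ => t ^ (n + 2) := by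
    simpa using (pow_O hk).mul (hy.isBigO_one ℂ)
  have hγO : γ =O[𝓝 0] fun t : ℂ => t ^ n :=
    hxO.prod_left (hyO.trans (pow_O (by omega)))
  have hγ : Tendsto γ (𝓝 0) (𝓝 0) := by
    have hc : ContinuousAt γ 0 := by fun_prop
    have hγ0 : γ 0 = 0 := by
      simp [γ, zero_pow (show n ≠ 0 by omega), zero_pow (show k ≠ 0 by omega)]
    simpa [ContinuousAt, hγ0] using hc
  have hquad : (fun t => φ (γ t) - (α * (γ t).1 + β * (γ t).2)) =O[𝓝 0]
      fun t : ℂ => t ^ (n + 2) := by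
    refine (h.comp_tendsto hγ).trans ?_
    refine (hγO.norm_left.pow 2).trans ?_
    simpa [← pow_mul] using pow_O (show n + 2 ≤ n * 2 by omega)
  have hrem : (fun t => φ (γ t) - α * (t ^ n * x t)) =O[𝓝 0] fun t : ℂ => t ^ (n + 2) := by
    refine (hquad.add (hyO.const_mul_left β)).congr_left fun t => ?_
    simp only [γ]
    ring
  refine ⟨α, fun t => (φ (γ t) - α * (t ^ n * x t)) / t ^ n, ?_, ?_, ?_⟩
  · simp [zero_pow (show n ≠ 0 by omega)]
  · have hO : (fun t => (φ (γ t) - α * (t ^ n * x t)) / t ^ n) =O[𝓝 0] fun t : ℂ => t ^ 2 := by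
      obtain ⟨A, hA⟩ := hrem.bound
      refine IsBigO.of_bound (max A 0) (hA.mono fun t ht => ?_)
      rcases eq_or_ne t 0 with rfl | ht0
      · simp [zero_pow (show n ≠ 0 by omega)]
      · have hp : 0 < ‖t ^ n‖ := norm_pos_iff.2 (pow_ne_zero _ ht0)
        rw [norm_div, div_le_iff₀ hp]
        refine ht.trans ?_
        rw [pow_add, norm_mul, mul_comm ‖t ^ n‖, ← mul_assoc]
        gcongr
        exact le_max_left _ _
    rw [hasDerivAt_iff_isLittleO_nhds_zero]
    have ho : (fun t : ℂ => t ^ 2) =o[𝓝 0] fun t : ℂ => t := by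
      simpa using isLittleO_pow_pow (𝕜 := ℂ) (show 1 < 2 by norm_num)
    refine (hO.trans_isLittleO ho).congr_left fun t => ?_
    simp [zero_pow (show n ≠ 0 by omega)]
  · intro t ht
    have : t ^ n ≠ 0 := pow_ne_zero _ ht
    field_simp
    ring

theorem Pgen_zero_left (l K : ℕ) (hl : 1 ≤ l) (a : ℕ → ℂ) (a' t : ℂ) :
    Pgen l K a a' (0, t) = t * (∑ i ∈ Finset.range l, a i * t ^ i + a' * t ^ (l + K)) := by
  have hK : ((l : ℤ) + K + 1).toNat = l + K + 1 := by omega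
  simp only [Pgen, hK, Int.toNat_natCast, zero_mul, zero_add, mul_add, Finset.mul_sum]
  congr 1
  · exact Finset.sum_congr rfl fun i _ => by ring
  · ring

theorem Favre_fst_eq {n l e : ℕ} (hl : 1 ≤ l) (he : n ≤ e) (k : ℕ) (lam c : ℂ) (b : ℕ → ℂ)
    (x w : ℂ) :
    (Favre n (n + l - 1) k e lam c b (x, w)).1 =
      w ^ n * (lam * x * w ^ (l - 1) +
        (∑ j ∈ Finset.range l, b (n + j) * w ^ j + c * w ^ (e - n))) := by
  obtain ⟨e, rfl⟩ := Nat.exists_eq_add_of_le he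
  obtain ⟨l, rfl⟩ := Nat.exists_eq_add_of_le' hl
  have h : ∑ i ∈ Finset.Icc n (n + (l + 1) - 1), b i * w ^ i =
      w ^ n * ∑ j ∈ Finset.range (l + 1), b (n + j) * w ^ j := by
    have hI : Finset.Icc n (n + (l + 1) - 1) = Finset.Ico n (n + (l + 1)) := by
      ext i; simp only [Finset.mem_Icc, Finset.mem_Ico]; omega
    rw [hI, Finset.sum_Ico_eq_sum_range, Finset.mul_sum, Nat.add_sub_cancel_left]
    exact Finset.sum_congr rfl fun i _ => by ring
  have hn : n + (l + 1) - 1 = n + l := by omega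
  simp only [Favre, h, Nat.add_sub_cancel_left, Nat.add_sub_cancel]
  rw [hn]
  ring

/-- under the extra assumptions `p ≥ 1`, `q ≥ 1`, `l ≥ 2`,
`r + s > p + q + 1`, a conjugation `F ∘ φ = φ ∘ G` near `0` forces
`b_{p+q+1} C a₀ (r+s) = (ps - qr) a₁`. -/
theorem conjugation_determines_first_b_coefficient
    (p q r s l δ K : ℤ)
    (hp : 0 ≤ p) (hq : 0 ≤ q) (hr : 1 ≤ r) (hs : 1 ≤ s) (hl : 1 ≤ l)
    (hδ : δ = p * s - q * r) (hδ1 : δ = 1 ∨ δ = -1) (hpq : p + q < r + s)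
    (hp1 : 1 ≤ p) (hq1 : 1 ≤ q) (hl2 : 2 ≤ l) (hpq1 : p + q + 1 < r + s)
    (hK : K = max 0 ((l - ((r + s) - (p + q))).fdiv (r + s - 1)))
    (a : ℕ → ℂ) (ha0 : a 0 ≠ 0) (a' : ℂ)
    (lam c : ℂ) (b : ℕ → ℂ) (hb : b (p + q).toNat = 1)
    (C : ℂ) (hC : C ≠ 0)
    (φ₁ μ : ℂ × ℂ → ℂ)
    (hφ₁ : AnalyticAt ℂ φ₁ 0) (hμ : AnalyticAt ℂ μ 0)
    (hφ₁0 : φ₁ 0 = 0) (hμ0 : μ 0 = 0)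
    (hconj : ∀ᶠ z : ℂ × ℂ in nhds 0,
      Favre (p + q).toNat (p + q + l - 1).toNat (r + s).toNat ((r + s) * (K + 1)).toNat
          lam c b (φ₁ z, C * z.2 * (1 + μ z))
        = (φ₁ (Ggen p q r s l K a a' z),
           C * (Ggen p q r s l K a a' z).2 * (1 + μ (Ggen p q r s l K a a' z)))) :
    b (p + q + 1).toNat * C * a 0 * ((r + s : ℤ) : ℂ)
      = ((p * s - q * r : ℤ) : ℂ) * a 1 := by
  lift p to ℕ using hp
  lift q to ℕ using hq
  lift r to ℕ using by omega
  lift s to ℕ using by omega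
  lift l to ℕ using by omega
  lift K to ℕ using by rw [hK]; exact le_max_left _ _
  clear hK hδ hδ1
  have hln : 2 ≤ l := by omega
  have hn2 : 2 ≤ p + q := by omega
  have hnk : p + q + 2 ≤ r + s := by omega
  have hke : r + s ≤ (r + s) * (K + 1) := Nat.le_mul_of_pos_right _ (Nat.succ_pos K)
  have e1 : ((p : ℤ) + q).toNat = p + q := by omega
  have e2 : ((p : ℤ) + q + l - 1).toNat = p + q + l - 1 := by omega
  have e3 : ((r : ℤ) + s).toNat = r + s := by omega
  have e4 : (((r : ℤ) + s) * (K + 1)).toNat = (r + s) * (K + 1) := by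
    exact_mod_cast Int.toNat_natCast ((r + s) * (K + 1))
  have e5 : ((p : ℤ) + q + 1).toNat = p + q + 1 := by omega
  rw [e1, e2, e3, e4] at hconj
  rw [e1] at hb
  rw [e5]
  clear e1 e2 e3 e4 e5
  set n := p + q with hn
  set k := r + s with hk
  let U : ℂ → ℂ := fun t => ∑ i ∈ Finset.range l, a i * t ^ i + a' * t ^ (l + K)
  let S : ℂ → ℂ := fun w =>
    ∑ j ∈ Finset.range l, b (n + j) * w ^ j + c * w ^ (k * (K + 1) - n)
  let g : ℂ → ℂ × ℂ := fun t => (t ^ n * U t ^ p, t ^ k * U t ^ r)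
  have hU : HasDerivAt U (a 1) 0 := hasDerivAt_sum_mul_pow_add_zero hln (by omega) a a'
  have hU0 : U 0 = a 0 := sum_mul_pow_add_apply_zero hln (by omega) a a'
  have hS : HasDerivAt S (b (n + 1)) 0 :=
    hasDerivAt_sum_mul_pow_add_zero hln (by omega) (fun j => b (n + j)) c
  have hS0 : S 0 = 1 := by
    rw [← hb]
    exact sum_mul_pow_add_apply_zero hln (by omega) (fun j => b (n + j)) c
  have hG : ∀ t, Ggen p q r s l K a a' (0, t) = g t := by
    intro t
    simp only [Ggen, Pgen_zero_left l K (by omega), Int.toNat_natCast, g, U, hn, hk]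
    ext <;> simp only [mul_pow] <;> ring
  have hUpow : ∀ m : ℕ, HasDerivAt (fun t => U t ^ m) (m * a 0 ^ (m - 1) * a 1) 0 := by
    intro m
    simpa [hU0] using hU.fun_pow m
  have pow_mul_deriv : ∀ {m : ℕ} (j : ℕ), 2 ≤ m →
      HasDerivAt (fun t : ℂ => t ^ m * U t ^ j) 0 0 := by
    intro m j hm
    refine ((hasDerivAt_pow m (0 : ℂ)).fun_mul (hUpow j)).congr_deriv ?_
    simp [zero_pow (show m ≠ 0 by omega), zero_pow (show m - 1 ≠ 0 by omega)]
  have hg : HasDerivAt g 0 0 := (pow_mul_deriv p hn2).prodMk (pow_mul_deriv r (by omega))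
  have hg0 : g 0 = 0 := by
    simp [g, zero_pow (show n ≠ 0 by omega), zero_pow (show k ≠ 0 by omega)]
  have hline : HasDerivAt (fun t : ℂ => ((0 : ℂ), t)) (0, 1) 0 :=
    (hasDerivAt_const _ _).prodMk (hasDerivAt_id _)
  have deriv_line : ∀ {f : ℂ × ℂ → ℂ}, AnalyticAt ℂ f 0 →
      ∃ f', HasDerivAt (fun t : ℂ => f (0, t)) f' 0 := fun hf =>
    ⟨_, (show HasFDerivAt _ _ ((0 : ℂ), (0 : ℂ)) from
      hf.differentiableAt.hasFDerivAt).comp_hasDerivAt (0 : ℂ) hline⟩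
  obtain ⟨m', hm⟩ := deriv_line hμ
  obtain ⟨x', hx⟩ := deriv_line hφ₁
  have hM : HasDerivAt (fun t => μ (g t)) 0 0 := by
    have h : HasFDerivAt μ (fderiv ℂ μ 0) (g 0) := by
      rw [hg0]; exact hμ.differentiableAt.hasFDerivAt
    exact (h.comp_hasDerivAt (0 : ℂ) hg).congr_deriv (map_zero _)
  have hm0 : μ ((0 : ℂ), (0 : ℂ)) = 0 := hμ0
  have hx0 : φ₁ ((0 : ℂ), (0 : ℂ)) = 0 := hφ₁0
  have hM0 : μ (g 0) = 0 := by rw [hg0, hμ0]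
  let v : ℂ → ℂ := fun t => C * (1 + μ (0, t))
  have hv : HasDerivAt v (C * m') 0 := (hm.const_add 1).const_mul C
  have hv0 : v 0 = C := by simp [v, hm0]
  have hvpow : ∀ m : ℕ, HasDerivAt (fun t => v t ^ m) (m * C ^ (m - 1) * (C * m')) 0 := by
    intro m
    simpa [hv0] using hv.fun_pow m
  have hw : HasDerivAt (fun t => t * v t) C 0 := by
    simpa [hv0] using (hasDerivAt_id (0 : ℂ)).fun_mul hv
  have hconj' : ∀ᶠ t : ℂ in nhdsWithin 0 {0}ᶜ, t ≠ 0 ∧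
      Favre n (n + l - 1) k (k * (K + 1)) lam c b (φ₁ (0, t), t * v t) =
        (φ₁ (g t), C * (g t).2 * (1 + μ (g t))) := by
    have ht : Filter.Tendsto (fun t : ℂ => ((0 : ℂ), t)) (nhds 0) (nhds 0) :=
      hline.continuousAt
    filter_upwards [(ht.eventually hconj).filter_mono nhdsWithin_le_nhds,
      self_mem_nhdsWithin] with t h ht0
    refine ⟨ht0, ?_⟩
    rw [hG] at h
    rw [← h]
    simp only [v]
    ring_nf
  have second := HasDerivAt.eq_and_eq_of_eventuallyEq_nhdsNE (hvpow k)
    (((hUpow r).const_mul C).fun_mul (hM.const_add 1)) <| by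
      filter_upwards [hconj'] with t ⟨ht, h⟩
      have h2 := congrArg Prod.snd h
      simp only [Favre, g, mul_pow] at h2
      have htk : t ^ k ≠ 0 := pow_ne_zero _ ht
      apply mul_left_cancel₀ htk
      rw [h2]
      ring
  obtain ⟨α, ρ, hρ0, hρ, hφ⟩ := hφ₁.exists_hasDerivAt_curve_quotient hφ₁0 hn2 hnk
    (hUpow p).continuousAt (hUpow r).continuousAt
  have hSw : HasDerivAt (fun t => S (t * v t)) (b (n + 1) * C) 0 :=
    HasDerivAt.comp (h₂ := S) 0 (by simpa using hS) hw
  have first := HasDerivAt.eq_and_eq_of_eventuallyEq_nhdsNE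
    ((hvpow n).fun_mul (((hx.const_mul lam).fun_mul (hw.fun_pow (l - 1))).fun_add hSw))
    (((hUpow p).const_mul α).fun_add hρ) <| by
      filter_upwards [hconj'] with t ⟨ht, h⟩
      have h1 := congrArg Prod.fst h
      rw [Favre_fst_eq (by omega) (by omega)] at h1
      have htn : t ^ n ≠ 0 := pow_ne_zero _ ht
      apply mul_left_cancel₀ htn
      rw [← hφ t ht]
      refine Eq.trans ?_ h1
      simp only [S, mul_pow]
      ring
  obtain ⟨s0, s1⟩ := second
  obtain ⟨f0, f1⟩ := first
  have hl1 : l - 1 ≠ 0 := by omega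
  simp only [hv0, hU0, hM0, hx0, hS0, hρ0, zero_mul, mul_zero, zero_pow hl1, add_zero, zero_add,
    mul_one] at s0 s1 f0 f1
  have pow_pred : ∀ (x : ℂ) {m : ℕ}, 1 ≤ m → x ^ m = x ^ (m - 1) * x := fun x m h =>
    (pow_sub_one_mul (by omega) x).symm
  have hμ' : k * m' * a 0 = r * a 1 := by
    have hC' : C ^ k ≠ 0 := pow_ne_zero _ hC
    apply mul_left_cancel₀ hC'
    calc C ^ k * (k * m' * a 0) = k * C ^ (k - 1) * (C * m') * a 0 := by
          rw [pow_pred C (show 1 ≤ k by omega)]; ring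
      _ = C ^ k * (r * a 1) := by
          rw [s1, s0, pow_pred (a 0) (show 1 ≤ r by omega)]; ring
  have hb' : (n * m' + b (n + 1) * C) * a 0 = p * a 1 := by
    have hC' : C ^ n ≠ 0 := pow_ne_zero _ hC
    apply mul_left_cancel₀ hC'
    calc C ^ n * ((n * m' + b (n + 1) * C) * a 0)
        = (n * C ^ (n - 1) * (C * m') + C ^ n * (b (n + 1) * C)) * a 0 := by
          rw [pow_pred C (show 1 ≤ n by omega)]; ring
      _ = C ^ n * (p * a 1) := by
          rw [f1, f0, pow_pred (a 0) (show 1 ≤ p by omega)]; ring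
  have hnC : (n : ℂ) = p + q := by simp [hn]
  have hkC : (k : ℂ) = r + s := by simp [hk]
  rw [hnC] at hb'
  rw [hkC] at hμ'
  push_cast
  linear_combination (r + s : ℂ) * hb' - (p + q : ℂ) * hμ'
end
end

section
/- Assume (H). Let i, j, α, β be nonnegative integers with i ≥ 2 and α + β ≥ 1. If (r + s − 1)·(i·(p+q) + j·(r+s)) < (p + q + l − 1)·(r + s), then (l − 1)·i + α·(p+q) + β·(r+s) > j + p + q + l − 1. -/
/-- key inequality behind Lemma 4.12, part 1: if `i ≥ 2`,
`α + β ≥ 1` and `(i, j)` lies in the index set `E_∞`, i.e.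
`(r+s−1)(i(p+q) + j(r+s)) < (p+q+l−1)(r+s)`, then
`(l−1)i + α(p+q) + β(r+s) > j + p + q + l − 1`. -/
theorem index_set_degree_inequality
    (p q r s l δ : ℤ)
    (hp : 0 ≤ p) (hq : 0 ≤ q) (hr : 1 ≤ r) (hs : 1 ≤ s) (hl : 1 ≤ l)
    (hδ : δ = p * s - q * r) (hδ1 : δ = 1 ∨ δ = -1) (hpq : p + q < r + s)
    (i j α β : ℤ)
    (hi : 2 ≤ i) (hj : 0 ≤ j) (hα : 0 ≤ α) (hβ : 0 ≤ β) (hαβ : 1 ≤ α + β)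
    (hE : (r + s - 1) * (i * (p + q) + j * (r + s)) < (p + q + l - 1) * (r + s)) :
    (l - 1) * i + α * (p + q) + β * (r + s) > j + p + q + l - 1 := by
  have hP : 1 ≤ p + q := by
    by_contra! h
    obtain rfl : p = 0 := by omega
    obtain rfl : q = 0 := by omega
    omega
  have hN : 2 ≤ r + s := by omega
  rw [add_assoc j p q]
  generalize p + q = P at *
  generalize r + s = N at *
  obtain ⟨L, rfl⟩ : ∃ L, l = L + 1 := ⟨l - 1, by ring⟩
  have hL : 0 ≤ L := by omega
  have hdeg : P ≤ α * P + β * N := by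
    nlinarith [mul_nonneg hβ (sub_nonneg.2 hpq.le),
      mul_nonneg (sub_nonneg.2 hαβ) (zero_le_one.trans hP)]
  have key : j < L * (i - 1) := by
    by_contra! h
    have hiP : P * N ≤ (N - 1) * (i * P) := by
      have h₁ : 2 * P ≤ i * P := by gcongr
      have h₂ : (N - 1) * (2 * P) ≤ (N - 1) * (i * P) :=
        mul_le_mul_of_nonneg_left h₁ (by omega)
      nlinarith [mul_nonneg (zero_le_one.trans hP) (sub_nonneg.2 hN)]
    have hLj : L ≤ j := by nlinarith [mul_nonneg hL (sub_nonneg.2 hi)]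
    have hjN : L * N ≤ (N - 1) * (j * N) := by
      have h₁ : L * N ≤ j * N := mul_le_mul_of_nonneg_right hLj (by omega)
      have h₂ : 0 ≤ (N - 2) * (j * N) :=
        mul_nonneg (by omega) (mul_nonneg hj (by omega))
      linarith
    linarith
  linarith
end

section
/- Assume (H) and set 𝔰 := p + q + l − 1. For an integer m ≥ 0 define T_m := Σ_{t=0}^{m} (r+s)^t, and set T_{−1} := 0. Let m ≥ 0 and let j ≥ 1 be an integer with j·(r+s)^{m+1} ≤ 𝔰·T_m and j·(r+s)^m > 𝔰·T_{m−1}. Then: (a) (j + 𝔰)·(r+s)^{m+1} ≤ 𝔰·T_{m+1} and (j + 𝔰)·(r+s)^m > 𝔰·T_m; and (b) there is at most one pair (α, β) with α ∈ {0, 1} and β a nonnegative integer such that α·(p+q) + β·(r+s) = j + 𝔰. (Equivalently: if (0, j) ∈ E_m \ E_{m−1} and α(p+q) + β(r+s) = j + p + q + l − 1, then (α, β) ∈ E_{m+1} \ E_m, and such (α, β) with α ≤ 1 is unique.) -/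
/-- Lemma 4.12, part 5: with `𝔰 = p+q+l−1` and
`T_m = Σ_{t=0}^{m} (r+s)^t`, if `j ≥ 1` satisfies
`j(r+s)^{m+1} ≤ 𝔰 T_m` and `j(r+s)^m > 𝔰 T_{m−1}`, then
(a) `(j+𝔰)(r+s)^{m+1} ≤ 𝔰 T_{m+1}` and `(j+𝔰)(r+s)^m > 𝔰 T_m`, and
(b) there is at most one pair `(α, β)` with `α ∈ {0,1}`, `β ≥ 0` and
`α(p+q) + β(r+s) = j + 𝔰`. -/
theorem next_index_set_and_uniqueness
    (p q r s l δ : ℤ)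
    (hp : 0 ≤ p) (hq : 0 ≤ q) (hr : 1 ≤ r) (hs : 1 ≤ s) (hl : 1 ≤ l)
    (hδ : δ = p * s - q * r) (hδ1 : δ = 1 ∨ δ = -1) (hpq : p + q < r + s)
    (m : ℕ) (j : ℤ) (hj : 1 ≤ j)
    (h1 : j * (r + s) ^ (m + 1)
        ≤ (p + q + l - 1) * ∑ t ∈ Finset.range (m + 1), (r + s) ^ t)
    (h2 : j * (r + s) ^ m
        > (p + q + l - 1) * ∑ t ∈ Finset.range m, (r + s) ^ t) :
    ((j + (p + q + l - 1)) * (r + s) ^ (m + 1)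
        ≤ (p + q + l - 1) * ∑ t ∈ Finset.range (m + 2), (r + s) ^ t ∧
     (j + (p + q + l - 1)) * (r + s) ^ m
        > (p + q + l - 1) * ∑ t ∈ Finset.range (m + 1), (r + s) ^ t) ∧
    (∀ α β α' β' : ℤ, (α = 0 ∨ α = 1) → 0 ≤ β → (α' = 0 ∨ α' = 1) → 0 ≤ β' →
      α * (p + q) + β * (r + s) = j + (p + q + l - 1) →
      α' * (p + q) + β' * (r + s) = j + (p + q + l - 1) →
      α = α' ∧ β = β') := by
  have hrs : 0 < r + s := by linarith
  have hnd : ∀ k : ℤ, p + q ≠ k * (r + s) := by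
    intro k hk
    have h0 : p + q = 0 :=
      Int.eq_zero_of_dvd_of_nonneg_of_lt (by linarith) hpq (Dvd.intro_left k hk.symm)
    obtain rfl : p = 0 := by linarith
    obtain rfl : q = 0 := by linarith
    rcases hδ1 with h | h <;> simp [h] at hδ
  refine ⟨⟨?_, ?_⟩, ?_⟩
  · rw [Finset.sum_range_succ]
    linarith
  · rw [Finset.sum_range_succ]
    linarith
  · rintro α β α' β' (rfl | rfl) - (rfl | rfl) - h h'
    · exact ⟨rfl, mul_right_cancel₀ hrs.ne' (by linarith)⟩
    · exact absurd (by linarith) (hnd (β - β'))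
    · exact absurd (by linarith) (hnd (β' - β))
    · exact ⟨rfl, mul_right_cancel₀ hrs.ne' (by linarith)⟩
end

section
/- Assume (H) and set μ̄ := max{d, l + ⌊(l − d)/(r + s − 1)⌋}. Let G and G' be first-form germs with coefficient tuples (a₀, …, a_{l−1}, a'') and (a'₀, …, a'_{l−1}, a'''), where a₀ ≠ 0 and a'₀ ≠ 0. Let θ and μ be complex-analytic functions on a neighborhood of 0 ∈ ℂ² with θ(0) = μ(0) = 0, let φ(z₁,z₂) := (z₁·(1 + θ(z₁,z₂)), z₂·(1 + μ(z₁,z₂))), and suppose G' ∘ φ = φ ∘ G on a neighborhood of 0. If all partial derivatives of θ at 0 of total order between 1 and μ̄ vanish (equivalently, every Taylor coefficient t_{ij} of θ at 0 with 1 ≤ i + j ≤ μ̄ is zero), then θ vanishes identically on a neighborhood of 0; consequently μ also vanishes near 0 and φ is the identity near 0. -/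
noncomputable section

open Filter Topology Asymptotics

/-- `f t = 1 + c t ^ n + o(t ^ n)` as `t → 0`. -/
def HasUnitExpansion (f : ℂ → ℂ) (n : ℕ) (c : ℂ) : Prop :=
  Tendsto (fun t => (f t - 1) / t ^ n) (𝓝[≠] 0) (𝓝 c)

lemma HasUnitExpansion.tendsto_one {f : ℂ → ℂ} {n : ℕ} {c : ℂ} (hn : 1 ≤ n)
    (hf : HasUnitExpansion f n c) : Tendsto f (𝓝[≠] 0) (𝓝 1) := by
  have h1 : Tendsto (fun t : ℂ => t ^ n) (𝓝[≠] 0) (𝓝 0) := by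
    have : Tendsto (fun t : ℂ => t ^ n) (𝓝 0) (𝓝 (0 ^ n)) := (continuous_pow n).tendsto 0
    rw [zero_pow (by omega)] at this
    exact this.mono_left nhdsWithin_le_nhds
  have h2 := (hf.mul h1).add_const 1
  rw [mul_zero, zero_add] at h2
  refine h2.congr' ?_
  filter_upwards [self_mem_nhdsWithin] with t ht
  have : t ≠ 0 := ht
  field_simp
  ring

lemma HasUnitExpansion.mul {f g : ℂ → ℂ} {n : ℕ} {c e : ℂ} (hn : 1 ≤ n)
    (hf : HasUnitExpansion f n c) (hg : HasUnitExpansion g n e) :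
    HasUnitExpansion (fun t => f t * g t) n (c + e) := by
  have h := hf.add ((hf.tendsto_one hn).mul hg)
  rw [one_mul] at h
  refine h.congr fun t => ?_
  ring

lemma HasUnitExpansion.pow {f : ℂ → ℂ} {n : ℕ} {c : ℂ} (hn : 1 ≤ n)
    (hf : HasUnitExpansion f n c) (k : ℕ) :
    HasUnitExpansion (fun t => f t ^ k) n (k * c) := by
  induction k with
  | zero => simp [HasUnitExpansion]
  | succ k ih =>
    have h := ih.mul hn hf
    simp only [pow_succ]
    convert h using 1
    push_cast
    ring

lemma hasUnitExpansion_one_add {u : ℂ → ℂ} {n : ℕ} {c : ℂ}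
    (hu : Tendsto (fun t => u t / t ^ n) (𝓝[≠] 0) (𝓝 c)) :
    HasUnitExpansion (fun t => 1 + u t) n c := by
  simpa [HasUnitExpansion] using hu

lemma tendsto_div_pow_of_isBigO {u : ℂ → ℂ} {n m : ℕ} (hnm : n < m)
    (hu : u =O[𝓝[≠] 0] fun t : ℂ => t ^ m) :
    Tendsto (fun t => u t / t ^ n) (𝓝[≠] 0) (𝓝 0) := by
  have h : (fun t : ℂ => t ^ m) =o[𝓝[≠] 0] fun t : ℂ => t ^ n :=
    (isLittleO_pow_pow hnm).mono nhdsWithin_le_nhds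
  exact (hu.trans_isLittleO h).tendsto_div_nhds_zero

/-- The `n`-th coefficient of a polynomial whose quotient by `t ^ n` converges at `0`. -/
lemma Polynomial.coeff_eq_of_tendsto_div_pow (n : ℕ) :
    ∀ (Q : Polynomial ℂ) {c : ℂ},
      Tendsto (fun t => Q.eval t / t ^ n) (𝓝[≠] 0) (𝓝 c) → Q.coeff n = c := by
  induction n with
  | zero =>
    intro Q c h
    have h0 : Tendsto (fun t => Q.eval t) (𝓝[≠] 0) (𝓝 (Q.eval 0)) :=
      (Q.continuous.tendsto 0).mono_left nhdsWithin_le_nhds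
    simp only [pow_zero, div_one] at h
    rw [Polynomial.coeff_zero_eq_eval_zero]
    exact tendsto_nhds_unique h0 h
  | succ n ih =>
    intro Q c h
    have hpow : Tendsto (fun t : ℂ => t ^ (n + 1)) (𝓝[≠] 0) (𝓝 0) := by
      have := ((continuous_pow (n + 1)).tendsto (0 : ℂ)).mono_left
        (nhdsWithin_le_nhds (s := {0}ᶜ))
      simpa using this
    have h0 : Tendsto (fun t => Q.eval t) (𝓝[≠] 0) (𝓝 (Q.eval 0)) :=
      (Q.continuous.tendsto 0).mono_left nhdsWithin_le_nhds
    have h1 : Tendsto (fun t => Q.eval t) (𝓝[≠] 0) (𝓝 0) := by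
      have := h.mul hpow
      rw [mul_zero] at this
      refine this.congr' ?_
      filter_upwards [self_mem_nhdsWithin] with t ht
      have : t ≠ 0 := ht
      field_simp
    have hQ0 : Q.coeff 0 = 0 := by
      rw [Polynomial.coeff_zero_eq_eval_zero]
      exact tendsto_nhds_unique h0 h1
    have hQ : ∀ t, Q.eval t = t * Q.divX.eval t := by
      intro t
      conv_lhs => rw [← Polynomial.X_mul_divX_add Q]
      simp [hQ0]
    rw [← Polynomial.coeff_divX]
    apply ih
    refine h.congr' ?_
    filter_upwards [self_mem_nhdsWithin] with t ht
    have : t ≠ 0 := ht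
    rw [hQ]
    field_simp
    ring

/-- The degree `n` relation read off the second component along a line. -/
lemma linear_relation_of_snd {r s n : ℕ} (hr : 1 ≤ r) (hs : 1 ≤ s) (hn : 1 ≤ n)
    {x y h k : ℂ} (hx : x ≠ 0) (hy : y ≠ 0) {u v U : ℂ → ℂ}
    (hu : Tendsto (fun t => u t / t ^ n) (𝓝[≠] 0) (𝓝 h))
    (hv : Tendsto (fun t => v t / t ^ n) (𝓝[≠] 0) (𝓝 k))
    (hU : U =O[𝓝[≠] 0] fun t : ℂ => t ^ (n * (r + s)))
    (hsnd : ∀ᶠ t in 𝓝[≠] 0, (t * x * (1 + u t)) ^ r * (t * y * (1 + v t)) ^ s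
      = (t * x) ^ r * (t * y) ^ s * (1 + U t)) :
    r * h + s * k = 0 := by
  have h1 := ((hasUnitExpansion_one_add hu).pow hn r).mul hn
    ((hasUnitExpansion_one_add hv).pow hn s)
  have h2 : HasUnitExpansion (fun t => 1 + U t) n 0 :=
    hasUnitExpansion_one_add (tendsto_div_pow_of_isBigO (by nlinarith) hU)
  refine tendsto_nhds_unique h1 (Tendsto.congr' ?_ h2)
  filter_upwards [hsnd, self_mem_nhdsWithin] with t ht ht0
  have ht0 : t ≠ 0 := ht0
  have hm : (t * x) ^ r * (t * y) ^ s ≠ 0 := by positivity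
  have : (1 + u t) ^ r * (1 + v t) ^ s = 1 + U t := by
    apply mul_left_cancel₀ hm
    rw [← ht, mul_pow _ (1 + u t), mul_pow _ (1 + v t)]
    ring
  simp only [this]

/-- The degree `n` relation read off the first component along a line. -/
lemma linear_relation_of_fst {p q r s l K n : ℕ} (hr : 1 ≤ r) (hn : 1 ≤ n)
    (hbig : p + q + l * (r + s) + n < (n + 1) * (r + s))
    (hdeg : (r + s) * (l + K + 1) < p + q + l * (r + s) + n) (hl : 1 ≤ l)
    {x y h k : ℂ} (hx : x ≠ 0) (hy : y ≠ 0) {u v T U : ℂ → ℂ} (a b : ℕ → ℂ) (a' b' : ℂ)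
    (hu : Tendsto (fun t => u t / t ^ n) (𝓝[≠] 0) (𝓝 h))
    (hv : Tendsto (fun t => v t / t ^ n) (𝓝[≠] 0) (𝓝 k))
    (hT : T =O[𝓝[≠] 0] fun t : ℂ => t ^ (n * (r + s)))
    (hU : U =O[𝓝[≠] 0] fun t : ℂ => t ^ (n * (r + s)))
    (hsnd : ∀ᶠ t in 𝓝[≠] 0, (t * x * (1 + u t)) ^ r * (t * y * (1 + v t)) ^ s
      = (t * x) ^ r * (t * y) ^ s * (1 + U t))
    (hfst : ∀ᶠ t in 𝓝[≠] 0,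
      (t * x * (1 + u t)) ^ (p + r * l) * (t * y * (1 + v t)) ^ (q + s * l)
        + (∑ i ∈ Finset.range l,
            b i * ((t * x * (1 + u t)) ^ r * (t * y * (1 + v t)) ^ s) ^ (i + 1))
        + b' * ((t * x * (1 + u t)) ^ r * (t * y * (1 + v t)) ^ s) ^ (l + K + 1)
      = ((t * x) ^ (p + r * l) * (t * y) ^ (q + s * l)
        + (∑ i ∈ Finset.range l, a i * ((t * x) ^ r * (t * y) ^ s) ^ (i + 1))
        + a' * ((t * x) ^ r * (t * y) ^ s) ^ (l + K + 1)) * (1 + T t)) :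
    ((p + r * l : ℕ) : ℂ) * h + ((q + s * l : ℕ) : ℂ) * k = 0 := by
  set R := r + s with hR
  obtain ⟨M, hM⟩ : ∃ M, p + q + l * R + n = M + R :=
    ⟨p + q + (l - 1) * R + n, by obtain ⟨l, rfl⟩ := Nat.exists_eq_add_of_le' hl; simp; ring⟩
  have hMn : 1 ≤ M := by nlinarith
  have hMlt : M < n * R := by nlinarith
  have hT' : HasUnitExpansion (fun t => 1 + T t) M 0 :=
    hasUnitExpansion_one_add (tendsto_div_pow_of_isBigO hMlt hT)
  have hU' : HasUnitExpansion (fun t => 1 + U t) M 0 :=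
    hasUnitExpansion_one_add (tendsto_div_pow_of_isBigO hMlt hU)
  set m₀ := x ^ r * y ^ s with hm₀
  have hm : ∀ t : ℂ, (t * x) ^ r * (t * y) ^ s = m₀ * t ^ R := fun t => by
    rw [hm₀, hR]; ring
  set P := x ^ (p + r * l) * y ^ (q + s * l) with hP
  have hP0 : P ≠ 0 := by positivity
  have hmono : ∀ t : ℂ, (t * x) ^ (p + r * l) * (t * y) ^ (q + s * l)
      = P * t ^ (p + q + l * R) := fun t => by
    rw [hP, hR]; ring
  -- an expansion of order `M` multiplied by a positive power of the monomial is negligible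
  have hneg : ∀ (c : ℂ) (j : ℕ) {f : ℂ → ℂ}, HasUnitExpansion f M 0 →
      Tendsto (fun t => c * (m₀ * t ^ R) ^ (j + 1) * (f t - 1) / t ^ (M + R))
        (𝓝[≠] 0) (𝓝 0) := by
    intro c j f hf
    have hc : Tendsto (fun t : ℂ => c * (m₀ * t ^ R) ^ j * m₀) (𝓝[≠] 0)
        (𝓝 (c * (m₀ * 0 ^ R) ^ j * m₀)) :=
      ((by fun_prop : Continuous fun t : ℂ => c * (m₀ * t ^ R) ^ j * m₀).tendsto 0).mono_left
        nhdsWithin_le_nhds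
    have := hc.mul hf
    rw [mul_zero] at this
    refine this.congr' ?_
    filter_upwards [self_mem_nhdsWithin] with t ht
    have ht : t ≠ 0 := ht
    rw [pow_add t M R]
    field_simp
    ring
  have hlead := ((hasUnitExpansion_one_add hu).pow hn (p + r * l)).mul hn
    ((hasUnitExpansion_one_add hv).pow hn (q + s * l))
  set C := ((p + r * l : ℕ) : ℂ) * h + ((q + s * l : ℕ) : ℂ) * k with hC
  -- the difference of the parts depending on the monomial only
  set Q : Polynomial ℂ :=
    (∑ i ∈ Finset.range l,
      Polynomial.C ((a i - b i) * m₀ ^ (i + 1)) * Polynomial.X ^ (R * (i + 1)))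
    + Polynomial.C ((a' - b') * m₀ ^ (l + K + 1)) * Polynomial.X ^ (R * (l + K + 1)) with hQ
  have hQeval : ∀ t : ℂ, Q.eval t
      = (∑ i ∈ Finset.range l, (a i - b i) * (m₀ * t ^ R) ^ (i + 1))
        + (a' - b') * (m₀ * t ^ R) ^ (l + K + 1) := by
    intro t
    simp only [hQ, Polynomial.eval_add, Polynomial.eval_finsetSum, Polynomial.eval_mul,
      Polynomial.eval_C, Polynomial.eval_pow, Polynomial.eval_X, mul_pow, ← pow_mul, mul_assoc]
  have hQcoeff : Q.coeff (M + R) = 0 := by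
    rw [hQ, Polynomial.coeff_add, Polynomial.finsetSum_coeff, Finset.sum_eq_zero, zero_add,
      Polynomial.coeff_C_mul_X_pow, if_neg (by omega)]
    intro i hi
    have hi := Finset.mem_range.mp hi
    have : R * (i + 1) ≤ R * (l + K + 1) := Nat.mul_le_mul_left _ (by omega)
    rw [Polynomial.coeff_C_mul_X_pow, if_neg (by omega)]
  have hQlim : Tendsto (fun t => Q.eval t / t ^ (M + R)) (𝓝[≠] 0) (𝓝 (P * C)) := by
    have e1 : Tendsto (fun t => P * ((((1 + u t) ^ (p + r * l) * (1 + v t) ^ (q + s * l)) - 1)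
        / t ^ n)) (𝓝[≠] 0) (𝓝 (P * C)) := hlead.const_mul P
    have e2 : Tendsto (fun t => P * t ^ (p + q + l * R) * (1 + T t - 1) / t ^ (M + R))
        (𝓝[≠] 0) (𝓝 0) := by
      have hn0 := tendsto_div_pow_of_isBigO (n := n) (by nlinarith) hT
      have := hn0.const_mul P
      rw [mul_zero] at this
      refine this.congr' ?_
      filter_upwards [self_mem_nhdsWithin] with t ht
      have ht : t ≠ 0 := ht
      rw [← hM, pow_add t _ n]
      field_simp
      ring
    have e3 := tendsto_finsetSum (Finset.range l) fun i _ => hneg (a i) i hT'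
    have e4 := hneg a' (l + K) hT'
    have e5 := tendsto_finsetSum (Finset.range l) fun i _ =>
      hneg (b i) i (by simpa using hU'.pow hMn (i + 1))
    have e6 := hneg b' (l + K) (by simpa using hU'.pow hMn (l + K + 1))
    have e := ((((e1.sub e2).sub e3).sub e4).add e5).add e6
    simp only [Finset.sum_const_zero, sub_zero, add_zero] at e
    refine e.congr' ?_
    filter_upwards [self_mem_nhdsWithin, hfst, hsnd] with t ht h1 h2
    have ht : t ≠ 0 := ht
    have hexp : P * ((((1 + u t) ^ (p + r * l) * (1 + v t) ^ (q + s * l)) - 1) / t ^ n)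
        = P * t ^ (p + q + l * R) * (((1 + u t) ^ (p + r * l) * (1 + v t) ^ (q + s * l)) - 1)
          / t ^ (M + R) := by
      rw [← hM, pow_add t _ n]
      field_simp
    rw [hexp, ← Finset.sum_div, ← Finset.sum_div, ← sub_div, ← sub_div, ← sub_div, ← add_div,
      ← add_div, hQeval]
    congr 1
    rw [h2, mul_pow _ (1 + u t), mul_pow _ (1 + v t), hm] at h1
    have h3 : (t * x) ^ (p + r * l) * (1 + u t) ^ (p + r * l)
        * ((t * y) ^ (q + s * l) * (1 + v t) ^ (q + s * l))
        = P * t ^ (p + q + l * R) * ((1 + u t) ^ (p + r * l) * (1 + v t) ^ (q + s * l)) := by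
      rw [← hmono]; ring
    rw [h3, hmono] at h1
    simp only [mul_pow _ (1 + U t)] at h1
    simp only [sub_mul, mul_sub, mul_add, add_mul, Finset.sum_add_distrib, Finset.sum_sub_distrib,
      ← Finset.sum_mul, mul_one, ← mul_assoc] at h1 ⊢
    linear_combination h1
  have := Polynomial.coeff_eq_of_tendsto_div_pow _ Q hQlim
  rw [hQcoeff] at this
  exact (mul_eq_zero.mp this.symm).resolve_left hP0

/-- If all diagonal terms of order below `n` vanish, the function is `O(‖y‖ ^ n)`. -/
lemma HasFPowerSeriesAt.isBigO_norm_pow {E : Type*} [NormedAddCommGroup E] [NormedSpace ℂ E]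
    {f : E → ℂ} {P : FormalMultilinearSeries ℂ E ℂ} (hf : HasFPowerSeriesAt f P 0) {n : ℕ}
    (hP : ∀ i < n, ∀ w, P i (fun _ => w) = 0) :
    f =O[𝓝 0] fun y => ‖y‖ ^ n := by
  have h := hf.isBigO_sub_partialSum_pow n
  simp only [zero_add] at h
  refine h.congr_left fun y => ?_
  rw [FormalMultilinearSeries.partialSum, Finset.sum_eq_zero, sub_zero]
  intro i hi
  exact hP i (Finset.mem_range.mp hi) y

/-- If all diagonal terms of order below `n` vanish, the `n`-th one is the leading coefficient
along every line. -/
lemma HasFPowerSeriesAt.tendsto_div_pow {E : Type*} [NormedAddCommGroup E] [NormedSpace ℂ E]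
    {f : E → ℂ} {P : FormalMultilinearSeries ℂ E ℂ} (hf : HasFPowerSeriesAt f P 0) {n : ℕ}
    (hP : ∀ i < n, ∀ w, P i (fun _ => w) = 0) (w : E) :
    Tendsto (fun t : ℂ => f (t • w) / t ^ n) (𝓝[≠] 0) (𝓝 (P n fun _ => w)) := by
  have h := hf.isBigO_sub_partialSum_pow (n + 1)
  simp only [zero_add] at h
  have hline : Tendsto (fun t : ℂ => t • w) (𝓝[≠] 0) (𝓝 0) := by
    have : Tendsto (fun t : ℂ => t • w) (𝓝 0) (𝓝 ((0 : ℂ) • w)) :=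
      (by fun_prop : Continuous fun t : ℂ => t • w).tendsto 0
    rw [zero_smul] at this
    exact this.mono_left nhdsWithin_le_nhds
  have h1 : (fun t : ℂ => f (t • w) - t ^ n * P n fun _ => w)
      =O[𝓝[≠] 0] fun t : ℂ => t ^ (n + 1) := by
    have h2 := h.comp_tendsto hline
    refine (h2.congr_left (f₂ := fun t : ℂ => f (t • w) - t ^ n * P n fun _ => w)
      fun t => ?_).trans ?_
    · simp only [Function.comp]
      rw [FormalMultilinearSeries.partialSum, Finset.sum_range_succ, Finset.sum_eq_zero, zero_add]
      · have := (P n).map_smul_univ (fun _ => t) (fun _ => w)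
        simp only [Finset.prod_const, Finset.card_univ, Fintype.card_fin, smul_eq_mul] at this
        rw [this]
      · intro i hi
        exact hP i (Finset.mem_range.mp hi) _
    · refine IsBigO.of_bound (‖w‖ ^ (n + 1)) (Eventually.of_forall fun t => ?_)
      simp [norm_smul, mul_pow, mul_comm]
  have h3 := (tendsto_div_pow_of_isBigO (Nat.lt_succ_self n) h1).add_const (P n fun _ => w)
  rw [zero_add] at h3
  refine h3.congr' ?_
  filter_upwards [self_mem_nhdsWithin] with t ht
  have ht : t ≠ 0 := ht
  field_simp
  ring

/-- A function whose diagonal power series terms all vanish is locally zero. -/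
lemma HasFPowerSeriesAt.eventually_eq_zero_of_diag {E : Type*} [NormedAddCommGroup E]
    [NormedSpace ℂ E] {f : E → ℂ} {P : FormalMultilinearSeries ℂ E ℂ}
    (hf : HasFPowerSeriesAt f P 0) (hP : ∀ i w, P i (fun _ => w) = 0) :
    ∀ᶠ z in 𝓝 0, f z = 0 := by
  filter_upwards [hf.eventually_hasSum] with y hy
  simp only [hP, zero_add] at hy
  exact hy.unique hasSum_zero

/-- The first component of a first-form germ, for natural exponents. -/
def gfst (p q r s l K : ℕ) (a : ℕ → ℂ) (a' : ℂ) (z : ℂ × ℂ) : ℂ :=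
  z.1 ^ (p + r * l) * z.2 ^ (q + s * l)
    + (∑ i ∈ Finset.range l, a i * (z.1 ^ r * z.2 ^ s) ^ (i + 1))
    + a' * (z.1 ^ r * z.2 ^ s) ^ (l + K + 1)

lemma Gfirst_natCast (p q r s l K : ℕ) (a : ℕ → ℂ) (a' : ℂ) (z : ℂ × ℂ) :
    Gfirst p q r s l K a a' z = (gfst p q r s l K a a' z, z.1 ^ r * z.2 ^ s) := by
  have h1 : ((p : ℤ) + r * l).toNat = p + r * l := by norm_cast
  have h2 : ((q : ℤ) + s * l).toNat = q + s * l := by norm_cast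
  have h3 : ((l : ℤ) + K + 1).toNat = l + K + 1 := by norm_cast
  simp [Gfirst, gfst, h1, h2, h3]

lemma gfst_line_isBigO {p q r s l K : ℕ} (hl : 1 ≤ l) (a : ℕ → ℂ) (a' : ℂ) (w : ℂ × ℂ) :
    (fun t : ℂ => (gfst p q r s l K a a' (t • w), (t • w).1 ^ r * (t • w).2 ^ s))
      =O[𝓝[≠] 0] fun t : ℂ => t ^ (r + s) := by
  obtain ⟨l, rfl⟩ := Nat.exists_eq_add_of_le' hl
  have key : ∀ B : ℂ → ℂ, Continuous B →
      (fun t : ℂ => t ^ (r + s) * B t) =O[𝓝[≠] 0] fun t : ℂ => t ^ (r + s) := by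
    intro B hB
    have hB1 : B =O[𝓝[≠] 0] fun _ => (1 : ℂ) :=
      (hB.continuousAt.tendsto.isBigO_one ℂ).mono nhdsWithin_le_nhds
    simpa using (isBigO_refl (fun t : ℂ => t ^ (r + s)) (𝓝[≠] 0)).mul hB1
  refine IsBigO.prod_left ?_ ?_
  · refine (key (fun t => w.1 ^ r * w.2 ^ s * ((t * w.1) ^ (p + r * l) * (t * w.2) ^ (q + s * l)
      + (∑ i ∈ Finset.range (l + 1), a i * ((t * w.1) ^ r * (t * w.2) ^ s) ^ i)
      + a' * ((t * w.1) ^ r * (t * w.2) ^ s) ^ (l + 1 + K))) (by fun_prop)).congr_left fun t => ?_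
    have hm : t ^ (r + s) * (w.1 ^ r * w.2 ^ s) = (t * w.1) ^ r * (t * w.2) ^ s := by ring
    simp only [gfst, Prod.smul_fst, Prod.smul_snd, smul_eq_mul]
    rw [← mul_assoc, hm, mul_add, mul_add, Finset.mul_sum]
    congr 1
    · congr 1
      · ring
      · exact Finset.sum_congr rfl fun i _ => by ring
    · ring
  · refine (key (fun _ => w.1 ^ r * w.2 ^ s) (by fun_prop)).congr_left fun t => ?_
    simp only [Prod.smul_fst, Prod.smul_snd, smul_eq_mul]
    ring

lemma dense_fst_ne_zero_snd_ne_zero : Dense {w : ℂ × ℂ | w.1 ≠ 0 ∧ w.2 ≠ 0} :=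
  (dense_compl_singleton (0 : ℂ)).prod (dense_compl_singleton (0 : ℂ))

lemma FormalMultilinearSeries.diag_eq_zero_of_dense {P : FormalMultilinearSeries ℂ (ℂ × ℂ) ℂ}
    {n : ℕ} (h : ∀ w : ℂ × ℂ, w.1 ≠ 0 → w.2 ≠ 0 → P n (fun _ => w) = 0) (w : ℂ × ℂ) :
    P n (fun _ => w) = 0 := by
  have hc : Continuous fun w : ℂ × ℂ => P n (fun _ => w) :=
    (P n).cont.comp (continuous_pi fun _ => continuous_id)
  have := hc.ext_on dense_fst_ne_zero_snd_ne_zero (continuous_const (y := (0 : ℂ)))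
    fun w hw => h w hw.1 hw.2
  exact congrFun this w

/-- Exponent bounds beyond the critical order. -/
lemma exponent_bounds {p q r s l K n : ℕ} {μbar : ℤ} (hr : 1 ≤ r) (hs : 1 ≤ s)
    (hK : (K : ℤ) = max 0 (((l : ℤ) - ((r + s) - (p + q))).fdiv (r + s - 1)))
    (hμbar : μbar = max (((r : ℤ) + s) - (p + q))
        (l + ((l : ℤ) - ((r + s) - (p + q))).fdiv (r + s - 1)))
    (hn : μbar < n) :
    p + q + l * (r + s) + n < (n + 1) * (r + s) ∧
      (r + s) * (l + K + 1) < p + q + l * (r + s) + n := by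
  have hpos : (0 : ℤ) < (r : ℤ) + s - 1 := by omega
  rw [Int.fdiv_eq_ediv_of_nonneg _ hpos.le] at hK hμbar
  set f := ((l : ℤ) - ((r + s) - (p + q))) / (r + s - 1) with hf
  have h1 : f * ((r : ℤ) + s - 1) ≤ (l : ℤ) - ((r + s) - (p + q)) := Int.ediv_mul_le _ hpos.ne'
  have h2 : (l : ℤ) - ((r + s) - (p + q)) < (f + 1) * ((r : ℤ) + s - 1) :=
    Int.lt_ediv_add_one_mul_self _ hpos
  have h3 : ((r : ℤ) + s) - (p + q) < n := by omega
  have h4 : l + f + 1 ≤ n := by omega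
  have h5 := mul_le_mul_of_nonneg_right h4 hpos.le
  zify
  refine ⟨by nlinarith, ?_⟩
  rcases le_total f 0 with h | h
  · rw [max_eq_left h] at hK
    rw [hK]
    nlinarith
  · rw [max_eq_right h] at hK
    rw [hK]
    nlinarith

/-- Lemma 4.10: if a conjugation
`G' ∘ φ = φ ∘ G` holds near `0` with `φ(z₁,z₂) = (z₁(1+θ), z₂(1+μ))` tangent to
the identity, and all derivatives of `θ` at `0` of total order between `1` and
`μ̄ = max{d, l + ⌊(l−d)/(r+s−1)⌋}` vanish, then `θ ≡ 0` near `0`; consequently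
`μ ≡ 0` and `φ = id` near `0`. -/
theorem vanishing_of_theta
    (p q r s l δ K μbar : ℤ)
    (hp : 0 ≤ p) (hq : 0 ≤ q) (hr : 1 ≤ r) (hs : 1 ≤ s) (hl : 1 ≤ l)
    (hδ : δ = p * s - q * r) (hδ1 : δ = 1 ∨ δ = -1) (hpq : p + q < r + s)
    (hK : K = max 0 ((l - ((r + s) - (p + q))).fdiv (r + s - 1)))
    (hμbar : μbar = max ((r + s) - (p + q))
        (l + (l - ((r + s) - (p + q))).fdiv (r + s - 1)))
    (a b : ℕ → ℂ) (ha0 : a 0 ≠ 0) (hb0 : b 0 ≠ 0) (a'' a''' : ℂ)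
    (θ μ : ℂ × ℂ → ℂ)
    (hθ : AnalyticAt ℂ θ 0) (hμ : AnalyticAt ℂ μ 0)
    (hθ0 : θ 0 = 0) (hμ0 : μ 0 = 0)
    (hconj : ∀ᶠ z : ℂ × ℂ in nhds 0,
      Gfirst p q r s l K b a''' (z.1 * (1 + θ z), z.2 * (1 + μ z))
        = ((Gfirst p q r s l K a a'' z).1 * (1 + θ (Gfirst p q r s l K a a'' z)),
           (Gfirst p q r s l K a a'' z).2 * (1 + μ (Gfirst p q r s l K a a'' z))))
    (hvanish : ∀ k : ℕ, 1 ≤ k → (k : ℤ) ≤ μbar → iteratedFDeriv ℂ k θ 0 = 0) :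
    (∀ᶠ z : ℂ × ℂ in nhds 0, θ z = 0) ∧
    (∀ᶠ z : ℂ × ℂ in nhds 0, μ z = 0) ∧
    (∀ᶠ z : ℂ × ℂ in nhds 0, (z.1 * (1 + θ z), z.2 * (1 + μ z)) = z) := by
  lift p to ℕ using hp
  lift q to ℕ using hq
  lift r to ℕ using by omega
  lift s to ℕ using by omega
  lift l to ℕ using by omega
  lift K to ℕ using hK ▸ le_max_left _ _
  have hr : 1 ≤ r := by exact_mod_cast hr
  have hs : 1 ≤ s := by exact_mod_cast hs
  have hl : 1 ≤ l := by exact_mod_cast hl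
  simp only [Gfirst_natCast, Prod.mk.injEq] at hconj
  obtain ⟨A, hA⟩ := hθ
  obtain ⟨B, hB⟩ := hμ
  have hdiag : ∀ n, ∀ w, A n (fun _ => w) = 0 ∧ B n (fun _ => w) = 0 := by
    intro n
    induction n using Nat.strong_induction_on with
    | _ n ih =>
    rcases Nat.eq_zero_or_pos n with rfl | hn
    · intro w
      have h1 := hA.coeff_zero (fun _ => w)
      have h2 := hB.coeff_zero (fun _ => w)
      exact ⟨h1.trans hθ0, h2.trans hμ0⟩
    have hAlow : ∀ i < n, ∀ w, A i (fun _ => w) = 0 := fun i hi w => (ih i hi w).1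
    have hBlow : ∀ i < n, ∀ w, B i (fun _ => w) = 0 := fun i hi w => (ih i hi w).2
    have key : ∀ w : ℂ × ℂ, w.1 ≠ 0 → w.2 ≠ 0 →
        A n (fun _ => w) = 0 ∧ B n (fun _ => w) = 0 := by
      intro w hw1 hw2
      have hline : Tendsto (fun t : ℂ => t • w) (𝓝[≠] 0) (𝓝 0) := by
        have : Tendsto (fun t : ℂ => t • w) (𝓝 0) (𝓝 ((0 : ℂ) • w)) :=
          (by fun_prop : Continuous fun t : ℂ => t • w).tendsto 0
        rw [zero_smul] at this
        exact this.mono_left nhdsWithin_le_nhds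
      have hGO := gfst_line_isBigO (p := p) (q := q) (r := r) (s := s) (K := K) hl a a'' w
      have hG0 : Tendsto
          (fun t : ℂ => (gfst p q r s l K a a'' (t • w), (t • w).1 ^ r * (t • w).2 ^ s))
          (𝓝[≠] 0) (𝓝 0) := by
        refine hGO.trans_tendsto ?_
        have := ((continuous_pow (r + s)).tendsto (0 : ℂ)).mono_left
          (nhdsWithin_le_nhds (s := {0}ᶜ))
        rwa [zero_pow (by omega)] at this
      have hcomp : ∀ {f : ℂ × ℂ → ℂ}, (f =O[𝓝 0] fun y => ‖y‖ ^ n) →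
          (fun t : ℂ => f (gfst p q r s l K a a'' (t • w), (t • w).1 ^ r * (t • w).2 ^ s))
            =O[𝓝[≠] 0] fun t : ℂ => t ^ (n * (r + s)) := by
        intro f hf
        refine (hf.comp_tendsto hG0).trans ((hGO.norm_norm.pow n).trans ?_)
        refine IsBigO.of_bound 1 (Eventually.of_forall fun t => ?_)
        simp [← pow_mul, mul_comm]
      have hT := hcomp (hA.isBigO_norm_pow hAlow)
      have hU := hcomp (hB.isBigO_norm_pow hBlow)
      have hu := hA.tendsto_div_pow hAlow w
      have hv := hB.tendsto_div_pow hBlow w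
      have hev := hline.eventually hconj
      have hsnd := hev.mono fun t ht => ht.2
      have hfst := hev.mono fun t ht => ht.1
      have hrel := linear_relation_of_snd hr hs hn hw1 hw2 hu hv hU hsnd
      have hs0 : (s : ℂ) ≠ 0 := by exact_mod_cast (by omega : s ≠ 0)
      have hh : A n (fun _ => w) = 0 := by
        rcases le_or_gt (n : ℤ) μbar with hle | hlt
        · obtain ⟨ρ, hρ⟩ := hA
          have h1 := hρ.factorial_smul w n
          rw [hvanish n hn hle] at h1
          simpa [Nat.factorial_ne_zero] using h1
        · obtain ⟨hbig, hdeg⟩ := exponent_bounds hr hs hK hμbar hlt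
          have hrel' := linear_relation_of_fst hr hn hbig hdeg hl hw1 hw2 a b a'' a'''
            hu hv hT hU hsnd hfst
          have hδC : (p : ℂ) * s - q * r ≠ 0 := by
            have : (p : ℤ) * s - q * r ≠ 0 := by rw [← hδ]; omega
            exact_mod_cast this
          refine (mul_eq_zero.mp ?_).resolve_left hδC
          push_cast at hrel'
          linear_combination (s : ℂ) * hrel' - (q + s * l) * hrel
      refine ⟨hh, ?_⟩
      rw [hh, mul_zero, zero_add] at hrel
      exact (mul_eq_zero.mp hrel).resolve_left hs0
    exact fun w =>
      ⟨FormalMultilinearSeries.diag_eq_zero_of_dense (fun w h1 h2 => (key w h1 h2).1) w,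
        FormalMultilinearSeries.diag_eq_zero_of_dense (fun w h1 h2 => (key w h1 h2).2) w⟩
  have hθz := hA.eventually_eq_zero_of_diag fun i w => (hdiag i w).1
  have hμz := hB.eventually_eq_zero_of_diag fun i w => (hdiag i w).2
  refine ⟨hθz, hμz, ?_⟩
  filter_upwards [hθz, hμz] with z h1 h2
  simp [h1, h2]
end
end
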